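/- arXiv:2001.00905 — 7 statements merged into one kernel-verified Lean document; each statement's English description precedes it below -/
import Mathlib

section
/- Let (T,d) be a real tree, Y a nonempty, closed, connected subset of T, and π_Y the nearest-point retraction onto Y. Then for all x,y ∈ T, either x and y lie in the same connected component of T∖Y, or d(x,y) = d(x,π_Y(x)) + d(π_Y(x),π_Y(y)) + d(π_Y(y),y). In particular, d(π_Y(x),π_Y(y)) ≤ d(x,y) for all x,y ∈ T. -/
open scoped NNReal ENNReal

noncomputable section

/-- `(T,d)` is a real tree: a nonempty complete metric space in which any two distinct
points are joined by an isometric arc all of whose intermediate points separate them. -/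
def IsRealTree (T : Type*) [MetricSpace T] : Prop :=
  Nonempty T ∧ CompleteSpace T ∧
    ∀ p q : T, p ≠ q → ∃ a b : ℝ, a < b ∧ ∃ α : ℝ → T,
      (∀ s ∈ Set.Icc a b, ∀ t ∈ Set.Icc a b, dist (α s) (α t) = |s - t|) ∧
      α a = p ∧ α b = q ∧
      ∀ c : ℝ, a < c → c < b →
        connectedComponentIn ({α c}ᶜ) p ≠ connectedComponentIn ({α c}ᶜ) q

/-- `S` is the segment `[x,y]`. -/
def IsSegment {T : Type*} [MetricSpace T] (x y : T) (S : Set T) : Prop :=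
  ∃ a b : ℝ, a ≤ b ∧ ∃ α : ℝ → T,
    (∀ s ∈ Set.Icc a b, ∀ t ∈ Set.Icc a b, dist (α s) (α t) = |s - t|) ∧
    α a = x ∧ α b = y ∧ S = α '' Set.Icc a b ∧
    ∀ c : ℝ, a < c → c < b →
      connectedComponentIn ({α c}ᶜ) x ≠ connectedComponentIn ({α c}ᶜ) y

/-- `B` is a `p`-branch: a connected component of `T \ {p}`. -/
def IsBranchAt {T : Type*} [MetricSpace T] (p : T) (B : Set T) : Prop :=
  ∃ x : T, x ≠ p ∧ B = connectedComponentIn ({p}ᶜ) x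

/-- `B` is a branch of `T`. -/
def IsBranch {T : Type*} [MetricSpace T] (B : Set T) : Prop :=
  ∃ p : T, IsBranchAt p B

/-- A subtree: a nonempty, closed, connected subset. -/
def IsSubtree {T : Type*} [MetricSpace T] (Y : Set T) : Prop :=
  Y.Nonempty ∧ IsClosed Y ∧ IsPreconnected Y

/-- The sampling map `ρ_r`. -/
def rho {X : Type*} (d : X → X → ℝ) (r : ℕ) (x : Fin r → X) : Fin r → Fin r → ℝ :=
  fun i j => if i = j then 0 else d (x i) (x j)

/-- The sampling measure `τ_r(X,d,μ)`: push-forward of `μ^r` along `ρ_r`. -/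
def samplingMeasure {X : Type*} [MeasurableSpace X] (d : X → X → ℝ) (r : ℕ)
    (μ : MeasureTheory.Measure X) : MeasureTheory.Measure (Fin r → Fin r → ℝ) :=
  MeasureTheory.Measure.map (rho d r) (MeasureTheory.Measure.pi fun _ => μ)

/-- Weak convergence of a sequence of measures. -/
def WeakTendsto {Ω : Type*} [MeasurableSpace Ω] [TopologicalSpace Ω]
    (μ : ℕ → MeasureTheory.Measure Ω) (ν : MeasureTheory.Measure Ω) : Prop :=
  ∀ g : BoundedContinuousFunction Ω ℝ,
    Filter.Tendsto (fun n => ∫ x, g x ∂(μ n)) Filter.atTop (nhds (∫ x, g x ∂ν))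

/-- A point `p` is an inner point if no `p`-branch has full measure. -/
def IsInnerPoint {T : Type*} [MetricSpace T] [MeasurableSpace T]
    (μ : MeasureTheory.Measure T) (p : T) : Prop :=
  ¬ ∃ B : Set T, IsBranchAt p B ∧ μ B = 1

/-- The core: the closure of the set of inner points. -/
def treeCore {T : Type*} [MetricSpace T] [MeasurableSpace T]
    (μ : MeasureTheory.Measure T) : Set T :=
  closure {p : T | IsInnerPoint μ p}

/-- Feathers: the connected components of `T \ Core(T)`. -/
def IsFeather {T : Type*} [MetricSpace T] [MeasurableSpace T]
    (μ : MeasureTheory.Measure T) (F : Set T) : Prop :=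
  ∃ x : T, x ∉ treeCore μ ∧ F = connectedComponentIn ((treeCore μ)ᶜ) x

/-- A long dendron: a real tree together with a Borel probability measure on
`A_D = T × [0,∞)` giving positive mass to `B × [0,∞)` for every branch `B` of `T`. -/
structure LongDendron where
  carrier : Type
  [met : MetricSpace carrier]
  [meas : MeasurableSpace carrier]
  [borelSpace : BorelSpace carrier]
  isRealTree : IsRealTree carrier
  ν : MeasureTheory.Measure (carrier × ℝ≥0)
  isProb : MeasureTheory.IsProbabilityMeasure ν
  branch_pos : ∀ B : Set carrier, IsBranch B → 0 < ν (B ×ˢ Set.univ)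

attribute [instance] LongDendron.met LongDendron.meas LongDendron.borelSpace

/-- `d_D((u,a),(v,b)) = d(u,v) + a + b`. -/
def LongDendron.dD (D : LongDendron) (x y : D.carrier × ℝ≥0) : ℝ :=
  dist x.1 y.1 + (x.2 : ℝ) + (y.2 : ℝ)

/-- `τ_r(D)` for a long dendron `D`. -/
def LongDendron.samp (D : LongDendron) (r : ℕ) :
    MeasureTheory.Measure (Fin r → Fin r → ℝ) :=
  samplingMeasure D.dD r D.ν

/-- A dendron: a long dendron with `d_D ≤ 1` `ν²`-almost surely. -/
def LongDendron.IsDendron (D : LongDendron) : Prop :=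
  (D.ν.prod D.ν) {x : (D.carrier × ℝ≥0) × (D.carrier × ℝ≥0) | 1 < D.dD x.1 x.2} = 0

/-- The (combinatorial) diameter of a finite graph. -/
def graphDiam {V : Type*} [Fintype V] (G : SimpleGraph V) : ℕ :=
  Finset.sup Finset.univ fun p : V × V => G.dist p.1 p.2

/-- The shortest path distance normalized by the diameter. -/
def treeDist {V : Type*} [Fintype V] (G : SimpleGraph V) (u v : V) : ℝ :=
  (G.dist u v : ℝ) / (graphDiam G : ℝ)

/-- `τ_r(T)` for a finite tree: sampling from the uniform measure on the vertex set
with the normalized distance. -/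
def treeSamp {V : Type*} [Fintype V] (G : SimpleGraph V) (r : ℕ) :
    MeasureTheory.Measure (Fin r → Fin r → ℝ) :=
  @samplingMeasure V ⊤ (treeDist G) r
    ((Fintype.card V : ℝ≥0∞)⁻¹ • @MeasureTheory.Measure.count V ⊤)

/-- `(T,d,μ)` is an `A`-tree. -/
def IsATree {T : Type*} [MetricSpace T] [MeasurableSpace T] (n : ℕ)
    (A : Fin n → Fin n → ℝ) (μ : MeasureTheory.Measure T) : Prop :=
  ∃ q : Fin n → T,
    (∀ i j : Fin n, (if i = j then (0 : ℝ) else dist (q i) (q j)) = A i j) ∧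
    (∀ Y : Set T, IsSubtree Y → (∀ i, q i ∈ Y) → Y = Set.univ) ∧
    (∀ H : Set T, MeasurableSet H →
      μ H = ({i : Fin n | q i ∈ H}.ncard : ℝ≥0∞) / (n : ℝ≥0∞))

end

noncomputable section

/-- The associated projection `α(p) = (π(p), d(p, π(p)))` into `Core(T) × [0,∞)`,
for a given nearest-point retraction `π` onto the core. -/
def assocProj {T : Type*} [MetricSpace T] [MeasurableSpace T]
    (μ : MeasureTheory.Measure T) (π : T → T) (hπ : ∀ t, π t ∈ treeCore μ) :
    T → ↥(treeCore μ) × ℝ≥0 :=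
  fun p => (⟨π p, hπ p⟩, ⟨dist p (π p), dist_nonneg⟩)

/-- The Borel σ-algebra on `Core(T) × [0,∞)` (the core carrying the restricted metric). -/
def coreBorel {T : Type*} [MetricSpace T] [MeasurableSpace T]
    (μ : MeasureTheory.Measure T) : MeasurableSpace (↥(treeCore μ) × ℝ≥0) :=
  borel _

/-- The measure of the associated long dendron: push-forward of `μ` along the
associated projection. -/
def assocNu {T : Type*} [MetricSpace T] [MeasurableSpace T]
    (μ : MeasureTheory.Measure T) (π : T → T) (hπ : ∀ t, π t ∈ treeCore μ) :
    @MeasureTheory.Measure (↥(treeCore μ) × ℝ≥0) (coreBorel μ) :=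
  letI : MeasurableSpace (↥(treeCore μ) × ℝ≥0) := coreBorel μ
  MeasureTheory.Measure.map (assocProj μ π hπ) μ

/-- `d_D` for the associated long dendron of a semi-measured real tree. -/
def coreDD {T : Type*} [MetricSpace T] [MeasurableSpace T]
    (μ : MeasureTheory.Measure T) (x y : ↥(treeCore μ) × ℝ≥0) : ℝ :=
  dist (x.1 : T) (y.1 : T) + (x.2 : ℝ) + (y.2 : ℝ)

end

open MeasureTheory Metric Filter Topology Set
open scoped NNReal ENNReal

noncomputable section

lemma tree_seg {T : Type} [MetricSpace T] (hT : IsRealTree T) (p q : T) :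
    ∃ S : Set T, IsCompact S ∧ IsPreconnected S ∧ p ∈ S ∧ q ∈ S ∧
      (∀ z ∈ S, dist p q = dist p z + dist z q) ∧
      (∀ C : Set T, IsPreconnected C → p ∈ C → q ∈ C → S ⊆ C) ∧
      (p ≠ q → ∃ m ∈ S, m ≠ p ∧ m ≠ q) := by
  by_cases hpq : p = q
  · subst hpq
    refine ⟨{p}, isCompact_singleton, isPreconnected_singleton, rfl, rfl, ?_, ?_, ?_⟩
    · rintro z rfl
      simp
    · intro C _ h _
      simpa using h
    · intro h
      exact absurd rfl h
  obtain ⟨a, b, hab, α, hiso, ha, hb, hsep⟩ := hT.2.2 p q hpq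
  have hc : ContinuousOn α (Set.Icc a b) := by
    rw [Metric.continuousOn_iff]
    intro s hs ε hε
    refine ⟨ε, hε, fun t ht h => ?_⟩
    rw [hiso t ht s hs]
    simpa [Real.dist_eq] using h
  have hA : a ∈ Set.Icc a b := ⟨le_rfl, hab.le⟩
  have hB : b ∈ Set.Icc a b := ⟨hab.le, le_rfl⟩
  refine ⟨α '' Set.Icc a b, isCompact_Icc.image_of_continuousOn hc,
    isPreconnected_Icc.image α hc, ⟨a, hA, ha⟩, ⟨b, hB, hb⟩, ?_, ?_, ?_⟩
  · rintro z ⟨t, ht, rfl⟩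
    rw [← ha, ← hb, hiso a hA b hB, hiso a hA t ht, hiso t ht b hB,
      abs_of_nonpos (by linarith), abs_of_nonpos (by linarith [ht.1]),
      abs_of_nonpos (by linarith [ht.2])]
    ring
  · rintro C hC hp hq z ⟨t, ht, rfl⟩
    rcases ht.1.eq_or_lt with h | h
    · rw [← h, ha]; exact hp
    rcases ht.2.eq_or_lt with h' | h'
    · rw [h', hb]; exact hq
    by_contra hz
    refine hsep t h h' (connectedComponentIn_eq ?_)
    have hCs : C ⊆ {α t}ᶜ := Set.subset_compl_singleton_iff.2 hz
    exact hC.subset_connectedComponentIn hp hCs hq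
  · intro _
    have hM : (a + b) / 2 ∈ Set.Icc a b := ⟨by linarith, by linarith⟩
    refine ⟨_, ⟨(a + b) / 2, hM, rfl⟩, ?_, ?_⟩
    · rw [← ha, ← dist_pos, hiso _ hM a hA, abs_pos]
      intro h; linarith
    · rw [← hb, ← dist_pos, hiso _ hM b hB, abs_pos]
      intro h; linarith

lemma tree_nearest {T : Type} [MetricSpace T] {Y S : Set T} {x p : T}
    (hd : ∀ z ∈ S, dist x p = dist x z + dist z p)
    (hp : ∀ y ∈ Y, dist x p ≤ dist x y) : ∀ z ∈ S, z ∈ Y → z = p := by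
  intro z hz hzY
  have h1 := hd z hz
  have h2 := hp z hzY
  have h3 : dist z p = 0 := le_antisymm (by linarith) dist_nonneg
  exact dist_eq_zero.1 h3

lemma tree_proj {T : Type} [MetricSpace T] (hT : IsRealTree T) {Y : Set T}
    (hconn : IsPreconnected Y) {x p z : T} (hpY : p ∈ Y) (hzY : z ∈ Y)
    (hp : ∀ y ∈ Y, dist x p ≤ dist x y) : dist x z = dist x p + dist p z := by
  obtain ⟨B, hBc, hBp, hB1, hB2, hBd, -, -⟩ := tree_seg hT x p
  obtain ⟨G, hGc, hGp, hG1, hG2, -, hGs, -⟩ := tree_seg hT p z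
  obtain ⟨D, hDc, hDp, hD1, hD2, hDd, hDs, -⟩ := tree_seg hT x z
  have hsub : D ⊆ B ∪ G := hDs _ (hBp.union p hB2 hG1 hGp) (Or.inl hB1) (Or.inr hG2)
  obtain ⟨w, hwD, hwB, hwG⟩ := isPreconnected_closed_iff.1 hDp B G hBc.isClosed hGc.isClosed
    hsub ⟨x, hD1, hB1⟩ ⟨z, hD2, hG2⟩
  have := tree_nearest hBd hp w hwB (hGs Y hconn hpY hzY hwG)
  subst this
  exact hDd _ hwD

/-- For the nearest-point retraction `π` onto a nonempty closed connected `Y`: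
unless `x` and `y` lie in the same component of `T∖Y`,
`d(x,y) = d(x,π x) + d(π x, π y) + d(π y, y)`; in particular `π` is 1-Lipschitz. -/
theorem statement5 {T : Type} [MetricSpace T] (hT : IsRealTree T)
    (Y : Set T) (hne : Y.Nonempty) (hcl : IsClosed Y) (hconn : IsPreconnected Y)
    (π : T → T) (hπY : ∀ t, π t ∈ Y)
    (hπ : ∀ t, ∀ y ∈ Y, dist t (π t) ≤ dist t y) :
    (∀ x y : T, y ∈ connectedComponentIn Yᶜ x ∨
      dist x y = dist x (π x) + dist (π x) (π y) + dist (π y) y) ∧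
    ∀ x y : T, dist (π x) (π y) ≤ dist x y := by
  have main : ∀ x y : T, y ∈ connectedComponentIn Yᶜ x ∨
      dist x y = dist x (π x) + dist (π x) (π y) + dist (π y) y := by
    intro x y
    obtain ⟨S, -, hSp, hx, hy, hd, -, -⟩ := tree_seg hT x y
    by_cases h : ∃ z ∈ S, z ∈ Y
    · right
      obtain ⟨z, hzS, hzY⟩ := h
      have h1 := tree_proj hT hconn (hπY x) hzY (hπ x)
      have h2 := tree_proj hT hconn (hπY y) hzY (hπ y)
      have h3 := hd z hzS
      have h4 := dist_triangle (π x) z (π y)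
      have h5 := dist_triangle4 x (π x) (π y) y
      rw [dist_comm z y] at h3
      rw [dist_comm z (π y)] at h4
      rw [dist_comm (π y) y] at h5 ⊢
      linarith
    · left
      push Not at h
      exact hSp.subset_connectedComponentIn hx (fun z hz => h z hz) hy
  refine ⟨main, fun x y => ?_⟩
  rcases main x y with h | h
  · suffices hxy : π x = π y by rw [hxy, dist_self]; exact dist_nonneg
    by_contra hne'
    have hx : x ∈ Yᶜ := by
      by_contra hx
      rw [connectedComponentIn_eq_empty hx] at h
      exact h
    obtain ⟨B, -, hBp, hB1, hB2, hBd, -, -⟩ := tree_seg hT x (π x)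
    obtain ⟨E, -, hEp, hE1, hE2, hEd, -, -⟩ := tree_seg hT y (π y)
    obtain ⟨G, -, -, -, -, -, hGs, hGm⟩ := tree_seg hT (π x) (π y)
    obtain ⟨m, hm, hmx, hmy⟩ := hGm hne'
    have hmY : m ∈ Y := hGs Y hconn (hπY x) (hπY y) hm
    have hxC := mem_connectedComponentIn hx
    have hU := (hBp.union x hB1 hxC isPreconnected_connectedComponentIn).union y
      (Or.inr h) hE1 hEp
    rcases hGs _ hU (Or.inl (Or.inl hB2)) (Or.inr hE2) hm with (h1 | h1) | h1
    · exact hmx (tree_nearest hBd (hπ x) m h1 hmY)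
    · exact connectedComponentIn_subset _ _ h1 hmY
    · exact hmy (tree_nearest hEd (hπ y) m h1 hmY)
  · have := dist_nonneg (x := x) (y := π x)
    have := dist_nonneg (x := π y) (y := y)
    linarith


end
end

section
/- Let (T,d) be a real tree. Then every branch of T belongs to the σ-algebra on T generated by the open metric balls of (T,d). Consequently, every branch is μ-measurable for every semi-measured real tree (T,d,μ). -/
open scoped NNReal ENNReal

open MeasureTheory Metric Filter Topology Set
open scoped NNReal ENNReal

noncomputable section

lemma rt_arc {T : Type} [MetricSpace T] (hT : IsRealTree T) (p q : T) :
    ∃ S : Set T, IsCompact S ∧ IsPreconnected S ∧ p ∈ S ∧ q ∈ S ∧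
      (∀ s ∈ S, dist p s + dist s q = dist p q) ∧
      (∀ s ∈ S, s ≠ p → s ≠ q →
        connectedComponentIn ({s}ᶜ) p ≠ connectedComponentIn ({s}ᶜ) q) ∧
      (∀ e : ℝ, 0 ≤ e → e ≤ dist p q → ∃ s ∈ S, dist p s = e) := by
  by_cases hpq : p = q
  · subst hpq
    refine ⟨{p}, isCompact_singleton, isPreconnected_singleton, rfl, rfl, ?_, ?_, ?_⟩
    · intro s hs
      rw [mem_singleton_iff] at hs
      simp [hs]
    · intro s hs h
      exact absurd hs h
    · intro e h0 h1
      refine ⟨p, rfl, ?_⟩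
      rw [dist_self] at *
      linarith
  · obtain ⟨a, b, hab, α, hα, ha, hb, hc⟩ := hT.2.2 p q hpq
    have hcont : ContinuousOn α (Icc a b) := by
      have : LipschitzOnWith 1 α (Icc a b) := by
        apply LipschitzOnWith.of_dist_le_mul
        intro s hs t ht
        rw [hα s hs t ht, Real.dist_eq]
        simp
      exact this.continuousOn
    have ma : a ∈ Icc a b := ⟨le_rfl, hab.le⟩
    have mb : b ∈ Icc a b := ⟨hab.le, le_rfl⟩
    have hd : dist p q = b - a := by
      rw [← ha, ← hb, hα a ma b mb, abs_of_nonpos (by linarith)]; ring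
    refine ⟨α '' Icc a b, isCompact_Icc.image_of_continuousOn hcont,
      isPreconnected_Icc.image α hcont, ⟨a, ma, ha⟩, ⟨b, mb, hb⟩, ?_, ?_, ?_⟩
    · rintro _ ⟨t, ht, rfl⟩
      rw [hd, ← ha, ← hb, hα a ma t ht, hα t ht b mb, abs_of_nonpos (by linarith [ht.1]),
        abs_of_nonpos (by linarith [ht.2])]
      ring
    · rintro _ ⟨t, ht, rfl⟩ h1 h2
      apply hc
      · exact lt_of_le_of_ne ht.1 (fun h => h1 (by rw [← h, ha]))
      · exact lt_of_le_of_ne ht.2 (fun h => h2 (by rw [h, hb]))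
    · intro e h0 h1
      have me : a + e ∈ Icc a b := ⟨by linarith, by linarith⟩
      refine ⟨α (a + e), ⟨_, me, rfl⟩, ?_⟩
      rw [← ha, hα a ma _ me, abs_of_nonpos (by linarith)]
      ring

/-- If `S` is preconnected, contains `y, z` and avoids `p`, they are in the same component. -/
lemma rt_comp {T : Type} [MetricSpace T] {p y z : T} {S : Set T} (hS : IsPreconnected S)
    (hy : y ∈ S) (hz : z ∈ S) (hp : p ∉ S) :
    connectedComponentIn ({p}ᶜ) y = connectedComponentIn ({p}ᶜ) z := by
  apply connectedComponentIn_eq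
  exact hS.subset_connectedComponentIn hy (fun s hs (h : s = p) => hp (h ▸ hs)) hz

lemma rt_eq {T : Type} [MetricSpace T] (hT : IsRealTree T) (p x : T) (hx : x ≠ p) :
    ∃ y : ℕ → T, connectedComponentIn ({p}ᶜ) x = {z | ∃ n, dist z (y n) < dist z p} := by
  obtain ⟨S, -, -, -, -, hSd, hSs, hSe⟩ := rt_arc hT p x
  have hpos : 0 < dist p x := dist_pos.2 hx.symm
  have he : ∀ n : ℕ, 0 < dist p x / (n + 2) ∧ dist p x / (n + 2) < dist p x := by
    intro n
    have : (0 : ℝ) < n + 2 := by positivity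
    refine ⟨by positivity, ?_⟩
    rw [div_lt_iff₀ this]
    have : (0 : ℝ) ≤ n := by positivity
    nlinarith
  choose y hyS hy using fun n : ℕ => hSe _ (he n).1.le (he n).2.le
  refine ⟨y, ?_⟩
  have hyx : ∀ n, connectedComponentIn ({p}ᶜ) (y n) = connectedComponentIn ({p}ᶜ) x := by
    intro n
    obtain ⟨R, -, hRc, hR1, hR2, hRd, -, -⟩ := rt_arc hT (y n) x
    refine rt_comp hRc hR1 hR2 (fun hp => ?_)
    have h1 := hRd p hp
    have h2 := hSd _ (hyS n)
    have h3 := (he n).1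
    rw [← hy n] at h3
    rw [dist_comm (y n) p] at h1
    linarith
  ext z
  constructor
  · intro hz
    have hzx := connectedComponentIn_eq hz
    have hzp : z ≠ p := fun h => connectedComponentIn_subset _ _ hz h
    obtain ⟨R, hRk, hRc, hR1, hR2, -, hRs, -⟩ := rt_arc hT z x
    have hpR : p ∉ R := fun h => hRs p h hzp.symm hx.symm hzx.symm
    obtain ⟨δ, hδ, hball⟩ := Metric.isOpen_iff.1 hRk.isClosed.isOpen_compl p hpR
    obtain ⟨n, hn⟩ : ∃ n : ℕ, dist p x / (n + 2) < δ := by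
      obtain ⟨n, hn⟩ := exists_nat_gt (dist p x / δ)
      refine ⟨n, ?_⟩
      rw [div_lt_iff₀ hδ] at hn
      rw [div_lt_iff₀ (by positivity)]
      nlinarith
    have hyR : y n ∉ R := hball (by rw [mem_ball, dist_comm, hy n]; exact hn)
    have hyp : y n ≠ p := fun h => by
      have h1 := hy n
      rw [h, dist_self] at h1
      linarith [(he n).1]
    have hyx' : y n ≠ x := fun h => by
      have h1 := hy n
      rw [h] at h1
      linarith [(he n).2]
    have hsep := hSs _ (hyS n) hyp hyx'
    rw [← rt_comp hRc hR1 hR2 hyR] at hsep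
    obtain ⟨Q, -, hQc, hQ1, hQ2, hQd, -, -⟩ := rt_arc hT p z
    have hyQ : y n ∈ Q := by
      by_contra h
      exact hsep (rt_comp hQc hQ1 hQ2 h)
    refine ⟨n, ?_⟩
    have h1 := hQd _ hyQ
    rw [hy n] at h1
    rw [dist_comm z, dist_comm z]
    linarith [(he n).1]
  · rintro ⟨n, hn⟩
    obtain ⟨R, -, hRc, hR1, hR2, hRd, -, -⟩ := rt_arc hT z (y n)
    have hpR : p ∉ R := fun h => by
      have := hRd p h
      linarith [dist_nonneg (x := p) (y := y n)]
    rw [← hyx n, ← rt_comp hRc hR1 hR2 hpR]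
    exact mem_connectedComponentIn (fun h => hpR (h ▸ hR1))

lemma rt_meas {T : Type} [MetricSpace T] (hT : IsRealTree T) (B : Set T) (hB : IsBranch B)
    (m : MeasurableSpace T) (hm : ∀ (x : T) (s : ℝ), MeasurableSet[m] (Metric.ball x s)) :
    MeasurableSet[m] B := by
  obtain ⟨p, x, hx, rfl⟩ := hB
  obtain ⟨y, hy⟩ := rt_eq hT p x hx
  have : connectedComponentIn ({p}ᶜ) x
      = ⋃ n : ℕ, ⋃ r : ℚ, (Metric.ball (y n) r \ Metric.ball p r) := by
    rw [hy]
    ext z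
    simp only [mem_setOf_eq, mem_iUnion, mem_diff, mem_ball, not_lt]
    refine exists_congr fun n => ⟨fun h => ?_, ?_⟩
    · obtain ⟨r, h1, h2⟩ := exists_rat_btwn h
      exact ⟨r, h1, h2.le⟩
    · rintro ⟨r, h1, h2⟩
      exact h1.trans_le h2
  rw [this]
  exact MeasurableSet.iUnion fun n => MeasurableSet.iUnion fun r => (hm _ _).diff (hm _ _)

/-- Every branch of a real tree lies in the σ-algebra generated by the open balls;
consequently branches are measurable in every semi-measured real tree. -/
theorem statement6 {T : Type} [MetricSpace T] (hT : IsRealTree T)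
    (B : Set T) (hB : IsBranch B) :
    MeasurableSet[MeasurableSpace.generateFrom
        {S : Set T | ∃ (x : T) (s : ℝ), S = Metric.ball x s}] B ∧
    ∀ (m : MeasurableSpace T) (μ : Measure T), IsProbabilityMeasure μ →
      (∀ (x : T) (s : ℝ), MeasurableSet[m] (Metric.ball x s)) →
      MeasurableSet[m] B := by
  refine ⟨rt_meas hT B hB _ fun x s => ?_, fun m μ _ hm => rt_meas hT B hB m hm⟩
  exact MeasurableSpace.measurableSet_generateFrom ⟨x, s, rfl⟩

end
end

section
/- Let (T,d,μ) be a semi-measured real tree. Then Core(T) is nonempty. Furthermore, a branch B of T intersects Core(T) if and only if μ(B) > 0. -/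
open scoped NNReal ENNReal

open MeasureTheory Metric Filter Topology Set
open scoped NNReal ENNReal

noncomputable section


section helpers
variable {T : Type} [MetricSpace T]

/-- metric betweenness -/
def MBtw (x p y : T) : Prop := dist x p + dist p y = dist x y

theorem MBtw.symm {x p y : T} (h : MBtw x p y) : MBtw y p x := by
  unfold MBtw at *
  rw [dist_comm y p, dist_comm p x, dist_comm y x]; linarith

theorem not_btw {x p y : T} : ¬ MBtw x p y ↔ dist x y < dist x p + dist p y := by
  unfold MBtw
  have := dist_triangle x p y
  constructor
  · intro h; exact lt_of_le_of_ne this (fun e => h e.symm)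
  · intro h e; linarith

theorem geo_set (hT : IsRealTree T) (x y : T) :
    ∃ S : Set T, IsPreconnected S ∧ x ∈ S ∧ y ∈ S ∧ (∀ z ∈ S, MBtw x z y) ∧
      (∀ t, 0 ≤ t → t ≤ dist x y → ∃ z ∈ S, dist x z = t) ∧
      (∀ z ∈ S, z ≠ x → z ≠ y →
        connectedComponentIn ({z}ᶜ) x ≠ connectedComponentIn ({z}ᶜ) y) := by
  by_cases hxy : x = y
  · subst hxy
    refine ⟨{x}, isPreconnected_singleton, rfl, rfl, ?_, ?_, ?_⟩
    · rintro z rfl; simp [MBtw]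
    · intro t h0 h1
      refine ⟨x, rfl, ?_⟩
      rw [dist_self] at *; linarith
    · rintro z rfl h; exact absurd rfl h
  obtain ⟨a, b, hab, α, hα, rfl, rfl, hsep⟩ := hT.2.2 x y hxy
  have ha : a ∈ Icc a b := ⟨le_rfl, hab.le⟩
  have hb : b ∈ Icc a b := ⟨hab.le, le_rfl⟩
  have hd : dist (α a) (α b) = b - a := by
    rw [hα a ha b hb, abs_sub_comm, abs_of_pos (by linarith)]
  have hda : ∀ t ∈ Icc a b, dist (α a) (α t) = t - a := by
    intro t ht
    rw [hα a ha t ht, abs_sub_comm, abs_of_nonneg (by linarith [ht.1])]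
  have hdb : ∀ t ∈ Icc a b, dist (α t) (α b) = b - t := by
    intro t ht
    rw [hα t ht b hb, abs_sub_comm, abs_of_nonneg (by linarith [ht.2])]
  refine ⟨α '' Icc a b, ?_, ⟨a, ha, rfl⟩, ⟨b, hb, rfl⟩, ?_, ?_, ?_⟩
  · apply isPreconnected_Icc.image
    have : LipschitzOnWith 1 α (Icc a b) := by
      apply LipschitzOnWith.of_dist_le_mul
      intro s hs t ht
      rw [hα s hs t ht, Real.dist_eq]; simp
    exact this.continuousOn
  · rintro _ ⟨t, ht, rfl⟩
    unfold MBtw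
    rw [hda t ht, hdb t ht, hd]; ring
  · intro t h0 h1
    rw [hd] at h1
    have : a + t ∈ Icc a b := ⟨by linarith, by linarith⟩
    exact ⟨_, ⟨a + t, this, rfl⟩, by rw [hda _ this]; ring⟩
  · rintro _ ⟨t, ht, rfl⟩ h1 h2
    apply hsep
    · exact lt_of_le_of_ne ht.1 (by rintro rfl; exact h1 rfl)
    · exact lt_of_le_of_ne ht.2 (by rintro rfl; exact h2 rfl)

theorem geo (hT : IsRealTree T) (x y : T) (t : ℝ) (h0 : 0 ≤ t) (h1 : t ≤ dist x y) :
    ∃ z, dist x z = t ∧ MBtw x z y := by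
  obtain ⟨S, -, -, -, h, h', -⟩ := geo_set hT x y
  obtain ⟨z, hz, e⟩ := h' t h0 h1
  exact ⟨z, e, h z hz⟩

theorem comp_of_not_btw (hT : IsRealTree T) {x p y : T} (h : ¬ MBtw x p y) :
    y ∈ connectedComponentIn ({p}ᶜ) x := by
  obtain ⟨S, hS, hx, hy, hb, -, -⟩ := geo_set hT x y
  refine hS.subset_connectedComponentIn hx ?_ hy
  rintro z hz rfl
  exact h (hb z hz)

theorem not_btw_of_comp (hT : IsRealTree T) {x p y : T} (hx : x ≠ p)
    (h : y ∈ connectedComponentIn ({p}ᶜ) x) : ¬ MBtw x p y := by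
  intro hb
  have hy : y ≠ p := connectedComponentIn_subset _ _ h
  obtain ⟨S, hS, hxS, hyS, hbt, hex, hsep⟩ := geo_set hT x y
  have hb' := hb
  unfold MBtw at hb
  obtain ⟨z, hz, hd⟩ := hex (dist x p) dist_nonneg (by linarith [dist_nonneg (x := p) (y := y)])
  have hbz := hbt z hz
  unfold MBtw at hbz
  by_cases hzp : z = p
  · subst hzp
    exact hsep z hz hx.symm hy.symm (connectedComponentIn_eq h)
  have hzx : z ≠ x := by
    rintro rfl
    rw [dist_self] at hd
    exact hx (dist_eq_zero.1 hd.symm)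
  have hzy : z ≠ y := by
    rintro rfl
    rw [dist_self] at hbz
    exact hy (dist_eq_zero.1 (by rw [dist_comm]; linarith))
  apply hsep z hz hzx hzy
  have hpos : 0 < dist z p := dist_pos.2 hzp
  have h1 : p ∈ connectedComponentIn ({z}ᶜ) x := by
    apply comp_of_not_btw hT
    unfold MBtw; intro e; linarith
  have h2 : y ∈ connectedComponentIn ({z}ᶜ) p := by
    apply comp_of_not_btw hT
    unfold MBtw; intro e
    rw [dist_comm p z] at e; linarith
  rw [connectedComponentIn_eq h1, connectedComponentIn_eq h2]

theorem tri (hT : IsRealTree T) {x p y : T} (h : MBtw x p y) (z : T) : MBtw x p z ∨ MBtw z p y := by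
  by_contra! hc
  obtain ⟨h1, h2⟩ := hc
  have hx : x ≠ p := by rintro rfl; apply h1; simp [MBtw]
  have a1 := comp_of_not_btw hT h1
  have a2 := comp_of_not_btw hT h2
  rw [← connectedComponentIn_eq a1] at a2
  exact not_btw_of_comp hT hx a2 h

/-- branch at `p` containing `x` -/
def br (p x : T) : Set T := {z | ¬ MBtw x p z}

theorem comp_eq (hT : IsRealTree T) {p x : T} (hx : x ≠ p) :
    connectedComponentIn ({p}ᶜ) x = br p x := by
  ext z
  exact ⟨fun h => not_btw_of_comp hT hx h, fun h => comp_of_not_btw hT h⟩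

theorem br_open (p x : T) : IsOpen (br p x) := by
  have : br p x = {z | dist x z < dist x p + dist p z} := by ext z; exact not_btw
  rw [this]
  exact isOpen_lt (by fun_prop) (by fun_prop)

theorem br_meas [MeasurableSpace T]
    (hballs : ∀ (x : T) (s : ℝ), MeasurableSet (Metric.ball x s)) (p x : T) :
    MeasurableSet (br p x) := by
  have hm : ∀ x : T, Measurable (fun z => dist x z) := by
    intro x
    apply measurable_of_Iio
    intro s
    convert hballs x s using 1
    ext z; simp [dist_comm]
  have : br p x = {z | dist x z < dist x p + dist p z} := by ext z; exact not_btw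
  rw [this]
  exact measurableSet_lt (hm x) ((hm p).const_add _)

theorem MBtw.trans_left {a b c d : T} (h1 : MBtw a b c) (h2 : MBtw a c d) : MBtw a b d := by
  unfold MBtw at *
  linarith [dist_triangle a b d, dist_triangle b c d]

theorem MBtw.trans_mid {a b c d : T} (h1 : MBtw a b c) (h2 : MBtw a c d) : MBtw b c d := by
  unfold MBtw at *
  linarith [dist_triangle a b d, dist_triangle b c d]

theorem btw_absurd {a b c : T} (h1 : MBtw a b c) (h2 : MBtw b a c) : a = b := by
  unfold MBtw at *
  rw [dist_comm b a] at h2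
  exact dist_eq_zero.1 (by linarith)

variable [MeasurableSpace T]

theorem lemmaN (hT : IsRealTree T) (μ : Measure T) {p x : T} (hx : x ≠ p)
    (h : ∀ q ∈ br p x, ∀ᵐ z ∂μ, ¬ MBtw p q z) : μ (br p x) = 0 := by
  have hpos : 0 < dist p x := dist_pos.2 hx.symm
  have : ∀ n : ℕ, ∃ u, dist p u = dist p x / (n + 1) ∧ MBtw p u x := fun n =>
    geo hT p x _ (by positivity) (div_le_self hpos.le (by linarith [n.cast_nonneg (α := ℝ)]))
  choose u hu1 hu2 using this
  have hup : ∀ n, p ≠ u n := by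
    intro n
    apply dist_pos.1
    rw [hu1]; positivity
  have hae : ∀ᵐ z ∂μ, ∀ n, ¬ MBtw p (u n) z := by
    rw [ae_all_iff]
    intro n
    apply h
    intro hb
    exact hup n (btw_absurd (hu2 n) hb.symm)
  have hlim : Tendsto u atTop (𝓝 p) := by
    rw [tendsto_iff_dist_tendsto_zero]
    simp_rw [dist_comm _ p, hu1]
    exact tendsto_const_div_atTop_nhds_zero_nat (dist p x) |>.comp (tendsto_add_atTop_nat 1) |>.congr
      (by intro n; simp)
  have : ∀ᵐ z ∂μ, z ∉ br p x := by
    filter_upwards [hae] with z hz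
    unfold br
    simp only [mem_setOf_eq, not_not]
    have hb : ∀ n, MBtw x (u n) z := fun n =>
      ((tri hT (hu2 n) z).resolve_left (hz n)).symm
    unfold MBtw at hb ⊢
    have h1 : Tendsto (fun n => dist x (u n) + dist (u n) z) atTop (𝓝 (dist x p + dist p z)) :=
      (tendsto_const_nhds.dist hlim).add (hlim.dist tendsto_const_nhds)
    simp_rw [hb] at h1
    exact tendsto_nhds_unique h1 tendsto_const_nhds
  rw [ae_iff] at this
  simpa using this

theorem full_ae {μ : Measure T} [IsProbabilityMeasure μ]
    (hballs : ∀ (x : T) (s : ℝ), MeasurableSet (Metric.ball x s)) {p x : T} :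
    μ (br p x) = 1 ↔ ∀ᵐ z ∂μ, ¬ MBtw x p z := by
  rw [← prob_compl_eq_zero_iff (br_meas hballs p x), ae_iff]
  rfl

theorem not_inner (hT : IsRealTree T) {μ : Measure T} [IsProbabilityMeasure μ]
    (hballs : ∀ (x : T) (s : ℝ), MeasurableSet (Metric.ball x s)) {p : T} :
    ¬ IsInnerPoint μ p ↔ ∃ x, x ≠ p ∧ ∀ᵐ z ∂μ, ¬ MBtw x p z := by
  unfold IsInnerPoint IsBranchAt
  rw [not_not]
  constructor
  · rintro ⟨B, ⟨x, hx, rfl⟩, h⟩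
    rw [comp_eq hT hx, full_ae hballs] at h
    exact ⟨x, hx, h⟩
  · rintro ⟨x, hx, h⟩
    refine ⟨_, ⟨x, hx, rfl⟩, ?_⟩
    rwa [comp_eq hT hx, full_ae hballs]

/-- if the full branch at `u` is not the one towards `q`, then almost everything is beyond `u` -/
theorem dichotomy (hT : IsRealTree T) {μ : Measure T} {u w q : T}
    (h : ∀ᵐ z ∂μ, ¬ MBtw w u z) :
    (∀ᵐ z ∂μ, ¬ MBtw q u z) ∨ (MBtw q u w ∧ ∀ᵐ z ∂μ, MBtw q u z) := by
  by_cases hb : MBtw q u w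
  · right
    refine ⟨hb, ?_⟩
    filter_upwards [h] with z hz
    exact (tri hT hb z).resolve_right (fun h' => hz h'.symm)
  · left
    filter_upwards [h] with z hz hq
    rcases tri hT hq w with h1 | h1
    · exact hb h1
    · exact hz h1

theorem exists_max (hT : IsRealTree T) (μ : Measure T) [IsProbabilityMeasure μ] (q0 : T) :
    ∃ q, (∀ᵐ z ∂μ, MBtw q0 q z) ∧ ∀ u, (∀ᵐ z ∂μ, MBtw q0 u z) → dist q0 u ≤ dist q0 q := by
  set S : Set T := {q | ∀ᵐ z ∂μ, MBtw q0 q z} with hS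
  have h0 : q0 ∈ S := by simp [hS, MBtw]
  have hne : (dist q0 '' S).Nonempty := ⟨_, q0, h0, rfl⟩
  have hbd : BddAbove (dist q0 '' S) := by
    by_contra hc
    rw [not_bddAbove_iff] at hc
    have : ∀ n : ℕ, ∃ q ∈ S, (n : ℝ) < dist q0 q := by
      intro n
      obtain ⟨_, ⟨q, hq, rfl⟩, h⟩ := hc n
      exact ⟨q, hq, h⟩
    choose q hq hqn using this
    obtain ⟨z, hz⟩ := (ae_all_iff.2 hq).exists
    obtain ⟨n, hn⟩ := exists_nat_gt (dist q0 z)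
    have := hz n
    unfold MBtw at this
    linarith [hqn n, dist_nonneg (x := q n) (y := z)]
  obtain ⟨s, -, hs1, hs2⟩ := exists_seq_tendsto_sSup hne hbd
  choose q hq hqs using hs2
  set r := sSup (dist q0 '' S) with hr
  have hae : ∀ᵐ z ∂μ, ∀ n, MBtw q0 (q n) z := ae_all_iff.2 hq
  obtain ⟨z0, hz0⟩ := hae.exists
  have hle : ∀ n, dist q0 (q n) ≤ r := fun n => le_csSup hbd ⟨_, hq n, rfl⟩
  have hr0 : 0 ≤ r := dist_nonneg.trans (hle 0)
  have hrz : r ≤ dist q0 z0 := by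
    apply le_of_tendsto' hs1
    intro n
    have := hz0 n
    unfold MBtw at this
    rw [← hqs]
    linarith [dist_nonneg (x := q n) (y := z0)]
  obtain ⟨p, hp1, hp2⟩ := geo hT q0 z0 r hr0 hrz
  have hdist : ∀ n, dist (q n) p = r - s n := by
    intro n
    rw [← hqs]
    have h1 := hz0 n
    have h2 := hle n
    rcases tri hT h1 p with h | h
    · unfold MBtw at h; linarith
    · unfold MBtw at h h1 hp2
      have := dist_nonneg (x := p) (y := q n)
      rw [dist_comm]; linarith
  have hlim : Tendsto q atTop (𝓝 p) := by
    rw [tendsto_iff_dist_tendsto_zero]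
    simp_rw [hdist]
    simpa using hs1.const_sub r
  refine ⟨p, ?_, ?_⟩
  · filter_upwards [hae] with z hb
    unfold MBtw at hb ⊢
    have h1 : Tendsto (fun n => dist q0 (q n) + dist (q n) z) atTop (𝓝 (dist q0 p + dist p z)) :=
      (tendsto_const_nhds.dist hlim).add (hlim.dist tendsto_const_nhds)
    simp_rw [hb] at h1
    exact tendsto_nhds_unique h1 tendsto_const_nhds
  · intro u hu
    rw [hp1]
    exact le_csSup hbd ⟨_, hu, rfl⟩

/-- membership in a branch propagates outward -/
theorem br_out (hT : IsRealTree T) {p x u v : T} (hu : u ∈ br p x) (h : MBtw p u v) :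
    v ∈ br p x := by
  intro hb
  rcases tri hT hb u with h1 | h1
  · exact hu h1
  · have := btw_absurd h h1
    subst this
    exact hu (by simp [MBtw])

theorem br_in (hT : IsRealTree T) {p x u v : T} (hv : v ∈ br p x) (h : MBtw p u v) (hne : p ≠ u) :
    u ∈ br p x := by
  intro hb
  rcases tri hT hb v with h1 | h1
  · exact hv h1
  · exact hne (btw_absurd h h1.symm)

theorem lemmaM (hT : IsRealTree T) (μ : Measure T) [IsProbabilityMeasure μ]
    (hballs : ∀ (x : T) (s : ℝ), MeasurableSet (Metric.ball x s)) {q0 x : T} (hx : x ≠ q0)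
    (hF : ∀ᵐ z ∂μ, ¬ MBtw x q0 z) : ∃ q ∈ br q0 x, IsInnerPoint μ q := by
  by_contra! hc
  obtain ⟨q, hq, hmax⟩ := exists_max hT μ q0
  have hG : ∃ y, y ≠ q ∧ (∀ᵐ z ∂μ, ¬ MBtw y q z) ∧ (q = q0 → y = x) ∧ (q ≠ q0 → q ∈ br q0 x) := by
    by_cases h : q = q0
    · subst h
      exact ⟨x, hx, hF, fun _ => rfl, fun h => absurd rfl h⟩
    · obtain ⟨z, hz1, hz2⟩ := (hq.and hF).exists
      have hqF : q ∈ br q0 x := br_in hT hz2 hz1 (Ne.symm h)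
      obtain ⟨y, hy, hy2⟩ := (not_inner hT hballs).1 (hc q hqF)
      exact ⟨y, hy, hy2, fun h' => absurd h' h, fun _ => hqF⟩
  obtain ⟨y, hy, hfull, he, hqF⟩ := hG
  have hz : μ (br q y) = 0 := by
    apply lemmaN hT μ hy
    intro u hu
    have hqu : MBtw q0 q u := by
      obtain ⟨z, hz1, hz2⟩ := (hq.and hfull).exists
      rcases tri hT hz1 u with h | h
      · exact h
      · rcases tri hT h y with h | h
        · exact absurd h.symm hu
        · exact absurd h hz2
    have hne : q ≠ u := by
      rintro rfl
      exact hu (by simp [MBtw])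
    have huF : u ∈ br q0 x := by
      by_cases h : q = q0
      · rw [he h, h] at hu; exact hu
      · exact br_out hT (hqF h) hqu
    obtain ⟨w, hw, hw2⟩ := (not_inner hT hballs).1 (hc u huF)
    rcases dichotomy hT (q := q0) hw2 with h | ⟨-, h⟩
    · filter_upwards [h, hq] with z h1 h2 h3
      apply h1
      unfold MBtw at *
      linarith
    · have h1 := hmax u h
      have := dist_pos.2 hne
      unfold MBtw at hqu
      linarith
  rw [(full_ae hballs).2 hfull] at hz
  exact one_ne_zero hz

end helpers

/-- The core of a semi-measured real tree is nonempty, and a branch meets the core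
iff it has positive measure. -/
theorem statement7 {T : Type} [MetricSpace T] [m : MeasurableSpace T]
    (hT : IsRealTree T) (μ : Measure T) [IsProbabilityMeasure μ]
    (hballs : ∀ (x : T) (s : ℝ), MeasurableSet (Metric.ball x s)) :
    (treeCore μ).Nonempty ∧
      ∀ B : Set T, IsBranch B → ((B ∩ treeCore μ).Nonempty ↔ 0 < μ B) := by
  have hmeet : ∀ p x : T, 0 < μ (br p x) → x ≠ p → ∃ q ∈ br p x, IsInnerPoint μ q := by
    intro p x hpos hx
    by_contra! hc
    apply hpos.ne'
    apply lemmaN hT μ hx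
    intro u hu
    obtain ⟨w, hw, hw2⟩ := (not_inner hT hballs).1 (hc u hu)
    rcases dichotomy hT (q := p) hw2 with h | ⟨hb, -⟩
    · exact h
    · exfalso
      obtain ⟨v, hv, hin⟩ := lemmaM hT μ hballs hw hw2
      refine hc v (br_out hT hu ?_) hin
      exact (tri hT hb v).resolve_right (fun h => hv h.symm)
  constructor
  · obtain ⟨q⟩ := hT.1
    by_cases hq : IsInnerPoint μ q
    · exact ⟨q, subset_closure hq⟩
    · obtain ⟨x, hx, hx2⟩ := (not_inner hT hballs).1 hq
      obtain ⟨v, -, hv⟩ := lemmaM hT μ hballs hx hx2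
      exact ⟨v, subset_closure hv⟩
  · rintro B ⟨p, x, hx, rfl⟩
    rw [comp_eq hT hx]
    constructor
    · rintro ⟨c, hcB, hc⟩
      obtain ⟨q, hqB, hq⟩ := mem_closure_iff.1 hc _ (br_open p x) hcB
      by_contra h0
      have h0 : μ (br p x) = 0 := by simpa using h0
      refine (not_inner hT hballs).2 ⟨p, ?_, ?_⟩ hq
      · rintro rfl
        exact hqB (by simp [MBtw])
      · have : ∀ᵐ z ∂μ, z ∉ br p x := measure_eq_zero_iff_ae_notMem.1 h0
        filter_upwards [this] with z hz hb
        exact hz (br_out hT hqB hb)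
    · intro hpos
      obtain ⟨q, hqB, hq⟩ := hmeet p x hpos hx
      exact ⟨q, hqB, subset_closure hq⟩

end
end

section
/- Let (T,d,μ) be a semi-measured real tree. Then Core(T) is connected. Moreover, if p,q ∈ Core(T), then every intermediate point of the segment [p,q] is an inner point. -/
open scoped NNReal ENNReal

open MeasureTheory Metric Filter Topology Set
open scoped NNReal ENNReal

noncomputable section

def RT8Btw {T : Type*} [MetricSpace T] (x z y : T) : Prop := dist x z + dist z y = dist x y

theorem RT8Btw.symm {T : Type*} [MetricSpace T] {x z y : T} (h : RT8Btw x z y) : RT8Btw y z x := by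
  unfold RT8Btw at *
  rw [dist_comm y z, dist_comm z x, dist_comm y x]; linarith

theorem rt8_arc {T : Type*} [MetricSpace T] {a b : ℝ} {α : ℝ → T}
    (h : ∀ s ∈ Set.Icc a b, ∀ t ∈ Set.Icc a b, dist (α s) (α t) = |s - t|) (hab : a ≤ b) :
    IsPreconnected (α '' Set.Icc a b) ∧ (∀ x ∈ α '' Set.Icc a b, RT8Btw (α a) x (α b)) := by
  constructor
  · apply IsPreconnected.image isPreconnected_Icc
    have : LipschitzOnWith 1 α (Set.Icc a b) := by
      apply LipschitzOnWith.of_dist_le_mul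
      intro x hx y hy
      rw [h x hx y hy, Real.dist_eq]; simp
    exact this.continuousOn
  · rintro _ ⟨t, ht, rfl⟩
    unfold RT8Btw
    have ha : a ∈ Set.Icc a b := ⟨le_rfl, hab⟩
    have hb : b ∈ Set.Icc a b := ⟨hab, le_rfl⟩
    rw [h a ha t ht, h t ht b hb, h a ha b hb, abs_of_nonpos, abs_of_nonpos, abs_of_nonpos]
    · ring
    · linarith
    · linarith [ht.2]
    · linarith [ht.1]

theorem rt8_geo {T : Type*} [MetricSpace T] (hT : IsRealTree T) (p q : T) :
    ∃ K : Set T, IsPreconnected K ∧ p ∈ K ∧ q ∈ K ∧ (∀ x ∈ K, RT8Btw p x q) ∧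
      (∀ t, 0 ≤ t → t ≤ dist p q → ∃ x ∈ K, dist p x = t) ∧
      ∀ x ∈ K, x ≠ p → x ≠ q →
        connectedComponentIn ({x}ᶜ) p ≠ connectedComponentIn ({x}ᶜ) q := by
  by_cases hpq : p = q
  · subst hpq
    refine ⟨{p}, isPreconnected_singleton, rfl, rfl, ?_, ?_, ?_⟩
    · rintro x rfl; simp [RT8Btw]
    · intro t h0 h1
      simp at h1
      exact ⟨p, rfl, by simp; linarith⟩
    · rintro x rfl h; exact absurd rfl h
  · obtain ⟨a, b, hab, α, h, rfl, rfl, hc⟩ := hT.2.2 p q hpq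
    obtain ⟨h1, h2⟩ := rt8_arc h hab.le
    have ha : a ∈ Set.Icc a b := ⟨le_rfl, hab.le⟩
    have hb : b ∈ Set.Icc a b := ⟨hab.le, le_rfl⟩
    refine ⟨_, h1, ⟨a, ha, rfl⟩, ⟨b, hb, rfl⟩, h2, ?_, ?_⟩
    · intro t ht0 ht1
      rw [h a ha b hb, abs_of_nonpos (by linarith)] at ht1
      have : a + t ∈ Set.Icc a b := ⟨by linarith, by linarith⟩
      refine ⟨_, ⟨a + t, this, rfl⟩, ?_⟩
      rw [h a ha _ this, abs_of_nonpos (by linarith)]; ring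
    · rintro _ ⟨c, hc', rfl⟩ h1 h2
      apply hc
      · exact lt_of_le_of_ne hc'.1 (by rintro rfl; exact h1 rfl)
      · exact lt_of_le_of_ne hc'.2 (by rintro rfl; exact h2 rfl)

theorem rt8_sep {T : Type*} [MetricSpace T] (hT : IsRealTree T) {p z q : T}
    (h : RT8Btw p z q) (hp : z ≠ p) (hq : z ≠ q) :
    connectedComponentIn ({z}ᶜ) p ≠ connectedComponentIn ({z}ᶜ) q := by
  obtain ⟨K, -, -, -, hK, hd, hs⟩ := rt8_geo hT p q
  have h' := h
  unfold RT8Btw at h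
  obtain ⟨y, hy, hyd⟩ := hd (dist p z) dist_nonneg (by linarith [dist_nonneg (x := z) (y := q)])
  have hyB := hK y hy
  by_cases hyz : y = z
  · subst hyz; exact hs y hy hp hq
  exfalso
  have hyp : y ≠ p := by
    rintro rfl; simp at hyd; exact hp hyd.symm
  have hyq : y ≠ q := by
    rintro rfl
    rw [hyd] at h
    exact hq (dist_eq_zero.1 (by linarith))
  apply hs y hy hyp hyq
  obtain ⟨K1, c1, p1, z1, b1, -, -⟩ := rt8_geo hT p z
  obtain ⟨K2, c2, z2, q2, b2, -, -⟩ := rt8_geo hT z q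
  have hc : IsPreconnected (K1 ∪ K2) := c1.union z z1 z2 c2
  apply connectedComponentIn_eq
  refine hc.subset_connectedComponentIn (Or.inl p1) ?_ (Or.inr q2)
  rintro u (hu | hu) (rfl : u = y)
  · have := b1 _ hu
    unfold RT8Btw at this
    exact hyz (dist_eq_zero.1 (by linarith))
  · have := b2 _ hu
    unfold RT8Btw at this hyB
    exact hyz (dist_eq_zero.1 (by rw [dist_comm]; linarith))

theorem rt8_comp {T : Type*} [MetricSpace T] (hT : IsRealTree T) {p z : T} (hp : p ≠ z) :
    connectedComponentIn ({z}ᶜ) p = {x | ¬ RT8Btw x z p} := by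
  ext x
  constructor
  · intro hx hb
    have hxz : x ≠ z := connectedComponentIn_subset _ _ hx
    exact rt8_sep hT hb hxz.symm hp.symm (connectedComponentIn_eq hx).symm
  · intro hx
    obtain ⟨K, c, xK, pK, b, -, -⟩ := rt8_geo hT x p
    refine c.subset_connectedComponentIn pK ?_ xK
    rintro u hu (rfl : u = z)
    exact hx (b _ hu)

theorem rt8_split {T : Type*} [MetricSpace T] (hT : IsRealTree T) {x z y : T} (w : T)
    (h : RT8Btw x z y) : RT8Btw x z w ∨ RT8Btw w z y := by
  by_cases hx : x = z
  · subst hx; left; simp [RT8Btw]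
  by_cases hy : y = z
  · subst hy; right; simp [RT8Btw]
  by_cases hw : w = z
  · subst hw; left; simp [RT8Btw]
  by_contra! hc
  have h1 : x ∈ connectedComponentIn ({z}ᶜ) w := by rw [rt8_comp hT hw]; exact hc.1
  have h2 : w ∈ connectedComponentIn ({z}ᶜ) y := by rw [rt8_comp hT hy]; exact hc.2
  rw [← connectedComponentIn_eq h2, rt8_comp hT hy] at h1
  exact h1 h

theorem rt8_inner {T : Type*} [MetricSpace T] [MeasurableSpace T] (hT : IsRealTree T)
    (μ : Measure T) [IsProbabilityMeasure μ]
    (hballs : ∀ (x : T) (s : ℝ), MeasurableSet (Metric.ball x s)) (z : T) :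
    ¬ IsInnerPoint μ z ↔ ∃ w, w ≠ z ∧ ∀ᵐ x ∂μ, ¬ RT8Btw x z w := by
  have hm : ∀ y : T, Measurable (fun x : T => dist x y) := by
    intro y
    apply measurable_of_Iio
    intro s
    exact hballs y s
  have hB : ∀ w : T, MeasurableSet {x | ¬ RT8Btw x z w} := by
    intro w
    have : MeasurableSet {x | RT8Btw x z w} :=
      measurableSet_eq_fun ((hm z).add_const _) (hm w)
    exact this.compl
  have key : ∀ w : T, μ {x | ¬ RT8Btw x z w} = 1 ↔ ∀ᵐ x ∂μ, ¬ RT8Btw x z w := by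
    intro w
    rw [← prob_compl_eq_zero_iff (hB w), ae_iff]
    rfl
  unfold IsInnerPoint IsBranchAt
  rw [not_not]
  constructor
  · rintro ⟨B, ⟨w, hw, rfl⟩, h⟩
    rw [rt8_comp hT hw] at h
    exact ⟨w, hw, (key w).1 h⟩
  · rintro ⟨w, hw, h⟩
    exact ⟨_, ⟨w, hw, rfl⟩, by rw [rt8_comp hT hw]; exact (key w).2 h⟩

theorem rt8_two {T : Type*} [MetricSpace T] (hT : IsRealTree T) {r p q x : T}
    (hp : RT8Btw r p x) (hq : RT8Btw r q x) (h : dist r p ≤ dist r q) :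
    dist p q = dist r q - dist r p := by
  have := rt8_split hT p hq
  unfold RT8Btw at *
  rcases this with h1 | h1
  · rw [dist_comm q p] at h1
    have := dist_nonneg (x := p) (y := q)
    linarith
  · linarith

theorem rt8_nonempty {T : Type*} [MetricSpace T] [MeasurableSpace T] (hT : IsRealTree T)
    (μ : Measure T) [IsProbabilityMeasure μ]
    (hballs : ∀ (x : T) (s : ℝ), MeasurableSet (Metric.ball x s)) :
    ∃ z, IsInnerPoint μ z := by
  by_contra! hno
  have hno' := fun z => (rt8_inner hT μ hballs z).1 (hno z)
  choose w hwz hw using hno'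
  obtain ⟨r⟩ := hT.1
  let A : Set T := {p | RT8Btw r p (w p)}
  have hA : ∀ p ∈ A, ∀ x, ¬ RT8Btw x p (w p) → RT8Btw r p x := by
    intro p hp x hx
    rcases rt8_split hT x hp with h | h
    · exact h
    · exact absurd h hx
  have hrA : r ∈ A := by simp [A, RT8Btw]
  have hne : (dist r '' A).Nonempty := ⟨_, r, hrA, rfl⟩
  have hbdd : BddAbove (dist r '' A) := by
    by_contra hb
    rw [not_bddAbove_iff] at hb
    have : ∀ n : ℕ, ∃ p ∈ A, (n : ℝ) < dist r p := by
      intro n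
      obtain ⟨_, ⟨p, hp, rfl⟩, h⟩ := hb n
      exact ⟨p, hp, h⟩
    choose p hp hn using this
    obtain ⟨x, hx⟩ := (ae_all_iff.2 fun n => hw (p n)).exists
    obtain ⟨n, hn'⟩ := exists_nat_gt (dist r x)
    have h1 := hA _ (hp n) x (hx n)
    unfold RT8Btw at h1
    linarith [hn n, dist_nonneg (x := p n) (y := x)]
  set L := sSup (dist r '' A) with hL
  have hle : ∀ p ∈ A, dist r p ≤ L := fun p hp => le_csSup hbdd ⟨p, hp, rfl⟩
  have : ∀ n : ℕ, ∃ p ∈ A, L - 1 / ((n : ℝ) + 1) < dist r p := by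
    intro n
    obtain ⟨_, ⟨p, hp, rfl⟩, h⟩ := exists_lt_of_lt_csSup hne
      (show L - 1 / ((n : ℝ) + 1) < L by
        have : (0 : ℝ) < 1 / ((n : ℝ) + 1) := by positivity
        linarith)
    exact ⟨p, hp, h⟩
  choose p hp hpn using this
  obtain ⟨x, hx⟩ := (ae_all_iff.2 fun n => hw (p n)).exists
  have hb : ∀ n, RT8Btw r (p n) x := fun n => hA _ (hp n) x (hx n)
  have hLx : L ≤ dist r x := by
    by_contra! hlt
    obtain ⟨n, hn⟩ := exists_nat_one_div_lt (sub_pos.2 hlt)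
    have h1 := hb n
    unfold RT8Btw at h1
    linarith [hpn n, dist_nonneg (x := p n) (y := x)]
  have hL0 : 0 ≤ L := dist_nonneg.trans (hle r hrA)
  obtain ⟨K, -, -, -, hK, hd, -⟩ := rt8_geo hT r x
  obtain ⟨c, hcK, hc⟩ := hd L hL0 hLx
  have hcx := hK c hcK
  have hpc : ∀ n, dist (p n) c < 1 / ((n : ℝ) + 1) := by
    intro n
    rw [rt8_two hT (hb n) hcx (by rw [hc]; exact hle _ (hp n)), hc]
    linarith [hpn n]
  by_cases hcA : c ∈ A
  · have hd0 : 0 < dist c (w c) := dist_pos.2 (hwz c).symm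
    have hys : ∀ n : ℕ, ∃ y, RT8Btw c y (w c) ∧ dist c y = dist c (w c) / ((n : ℝ) + 1) := by
      intro n
      obtain ⟨K, -, -, -, hK, hd, -⟩ := rt8_geo hT c (w c)
      obtain ⟨y, hy, h⟩ := hd (dist c (w c) / ((n : ℝ) + 1)) (by positivity)
        (div_le_self hd0.le (by linarith [n.cast_nonneg (α := ℝ)]))
      exact ⟨y, hK y hy, h⟩
    choose y hy hyd using hys
    have hry : ∀ n, dist r (y n) = dist r c + dist c (y n) := by
      intro n
      have h1 := hy n
      have h2 : RT8Btw r c (w c) := hcA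
      unfold RT8Btw at h1 h2
      linarith [dist_triangle r (y n) (w c), dist_triangle r c (y n)]
    have hyA : ∀ n, y n ∉ A := by
      intro n h
      have h1 := hle _ h
      have : 0 < dist c (y n) := by rw [hyd]; positivity
      linarith [hry n]
    obtain ⟨x, hx1, hx2⟩ := ((hw c).and (ae_all_iff.2 fun n => hw (y n))).exists
    have hpos : 0 < dist x c + dist c (w c) - dist x (w c) := by
      have h1 := dist_triangle x c (w c)
      have : dist x c + dist c (w c) ≠ dist x (w c) := hx1
      exact sub_pos.2 (lt_of_le_of_ne h1 this.symm)
    obtain ⟨n, hn⟩ := exists_nat_one_div_lt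
      (show 0 < (dist x c + dist c (w c) - dist x (w c)) / (2 * dist c (w c)) by positivity)
    have hn2 : 2 * dist c (y n) < dist x c + dist c (w c) - dist x (w c) := by
      rw [hyd]
      rw [lt_div_iff₀ (by positivity)] at hn
      calc _ = 1 / ((n : ℝ) + 1) * (2 * dist c (w c)) := by ring
        _ < _ := hn
    have hrx := hA c hcA x hx1
    have hcy : RT8Btw c (y n) x := by
      rcases rt8_split hT x (hy n) with h | h
      · exact h
      · exfalso
        have h1 := hy n
        unfold RT8Btw at h h1
        have := dist_triangle x (y n) c
        rw [dist_comm (y n) c] at this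
        linarith
    have hB : RT8Btw r (y n) x := by
      have := hry n
      unfold RT8Btw at *
      linarith
    rcases rt8_split hT (w (y n)) hB with h | h
    · exact hyA n h
    · exact hx2 n h.symm
  · obtain ⟨x, hx1, hx2⟩ := ((hw c).and (ae_all_iff.2 fun n => hw (p n))).exists
    have hB : RT8Btw r c x := by
      by_contra hB
      have hpos : 0 < dist r c + dist c x - dist r x :=
        sub_pos.2 (lt_of_le_of_ne (dist_triangle r c x) (fun h => hB h.symm))
      obtain ⟨n, hn⟩ := exists_nat_one_div_lt (half_pos hpos)
      have h1 := hA _ (hp n) x (hx2 n)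
      unfold RT8Btw at h1
      have h2 := dist_triangle r (p n) c
      have h3 := dist_triangle c (p n) x
      rw [dist_comm c (p n)] at h3
      linarith [hpc n]
    rcases rt8_split hT (w c) hB with h | h
    · exact hcA h
    · exact hx1 h.symm

theorem rt8_core {T : Type*} [MetricSpace T] [MeasurableSpace T] (hT : IsRealTree T)
    (μ : Measure T) [IsProbabilityMeasure μ]
    (hballs : ∀ (x : T) (s : ℝ), MeasurableSet (Metric.ball x s)) {x w p : T}
    (hw : ∀ᵐ y ∂μ, ¬ RT8Btw y x w) (hp : p ∈ treeCore μ) (hpx : p ≠ x) :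
    ¬ RT8Btw p x w := by
  intro hb
  obtain ⟨p', hp', hd⟩ := Metric.mem_closure_iff.1 hp (dist p x) (dist_pos.2 hpx)
  have hp'x : x ≠ p' := by rintro rfl; exact lt_irrefl _ hd
  have hb' : RT8Btw p' x w := by
    rcases rt8_split hT p' hb with h | h
    · unfold RT8Btw at h
      linarith [dist_nonneg (x := x) (y := p')]
    · exact h
  refine (rt8_inner hT μ hballs p').2 ⟨x, hp'x, ?_⟩ hp'
  filter_upwards [hw] with y hy h
  rcases rt8_split hT y hb' with h1 | h1
  · unfold RT8Btw at h h1
    rw [dist_comm p' y, dist_comm x y] at h1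
    exact hp'x (dist_eq_zero.1 (by rw [dist_comm]; linarith))
  · exact hy h1

theorem rt8_btw_inner {T : Type*} [MetricSpace T] [MeasurableSpace T] (hT : IsRealTree T)
    (μ : Measure T) [IsProbabilityMeasure μ]
    (hballs : ∀ (x : T) (s : ℝ), MeasurableSet (Metric.ball x s)) {x p q : T}
    (hp : p ∈ treeCore μ) (hq : q ∈ treeCore μ) (hb : RT8Btw p x q)
    (hxp : x ≠ p) (hxq : x ≠ q) : IsInnerPoint μ x := by
  by_contra hn
  obtain ⟨w, hwx, hw⟩ := (rt8_inner hT μ hballs x).1 hn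
  rcases rt8_split hT w hb with h | h
  · exact rt8_core hT μ hballs hw hp hxp.symm h
  · exact rt8_core hT μ hballs hw hq hxq.symm h.symm

/-- The core of a semi-measured real tree is connected, and all intermediate points
of a segment between core points are inner points. -/
theorem statement8 {T : Type} [MetricSpace T] [m : MeasurableSpace T]
    (hT : IsRealTree T) (μ : Measure T) [IsProbabilityMeasure μ]
    (hballs : ∀ (x : T) (s : ℝ), MeasurableSet (Metric.ball x s)) :
    IsConnected (treeCore μ) ∧
    ∀ p ∈ treeCore μ, ∀ q ∈ treeCore μ, ∀ S : Set T, IsSegment p q S →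
      ∀ x ∈ S, x ≠ p → x ≠ q → IsInnerPoint μ x := by
  refine ⟨⟨?_, ?_⟩, ?_⟩
  · obtain ⟨z, hz⟩ := rt8_nonempty hT μ hballs
    exact ⟨z, subset_closure hz⟩
  · apply isPreconnected_of_forall_pair
    intro p hp q hq
    obtain ⟨K, c, pK, qK, b, -, -⟩ := rt8_geo hT p q
    refine ⟨K, ?_, pK, qK, c⟩
    intro u hu
    by_cases h1 : u = p
    · rwa [h1]
    by_cases h2 : u = q
    · rwa [h2]
    exact subset_closure (rt8_btw_inner hT μ hballs hp hq (b u hu) h1 h2)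
  · rintro p hp q hq S ⟨a, b, hab, α, h, rfl, rfl, rfl, -⟩ x hx h1 h2
    exact rt8_btw_inner hT μ hballs hp hq ((rt8_arc h hab).2 x hx) h1 h2

end
end

section
/- Let (T,d,μ) be a semi-measured real tree and fix a point p₀ ∈ Core(T). Let Q be the set of inner points q of T such that d(p₀,q) is rational. Then Core(T) with the restriction of d is a separable metric space; moreover Q is countable and Q ∩ [p,q] is dense in [p,q] for every proper segment [p,q] with p,q ∈ Core(T), p≠q. -/
open scoped NNReal ENNReal

open MeasureTheory Metric Filter Topology Set
open scoped NNReal ENNReal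

noncomputable section

theorem aux_cont {T : Type*} [MetricSpace T] {α : ℝ → T} {a b : ℝ}
    (hα : ∀ s ∈ Set.Icc a b, ∀ t ∈ Set.Icc a b, dist (α s) (α t) = |s - t|) :
    ContinuousOn α (Set.Icc a b) := by
  have : LipschitzOnWith 1 α (Set.Icc a b) := by
    apply LipschitzOnWith.of_dist_le_mul
    intro s hs t ht
    rw [hα s hs t ht, Real.dist_eq]
    simp
  exact this.continuousOn

theorem aux_comp {T : Type*} [MetricSpace T] {α : ℝ → T} {a b s t : ℝ} {w : T}
    (hα : ∀ s ∈ Set.Icc a b, ∀ t ∈ Set.Icc a b, dist (α s) (α t) = |s - t|)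
    (hs : a ≤ s) (hst : s ≤ t) (ht : t ≤ b) (hw : ∀ c ∈ Set.Icc s t, α c ≠ w) :
    connectedComponentIn ({w}ᶜ) (α s) = connectedComponentIn ({w}ᶜ) (α t) := by
  have hc : ContinuousOn α (Set.Icc s t) := (aux_cont hα).mono (Set.Icc_subset_Icc hs ht)
  have hp : IsPreconnected (α '' Set.Icc s t) := isPreconnected_Icc.image _ hc
  apply connectedComponentIn_eq
  refine hp.subset_connectedComponentIn (Set.mem_image_of_mem _ (Set.left_mem_Icc.2 hst)) ?_
    (Set.mem_image_of_mem _ (Set.right_mem_Icc.2 hst))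
  rintro _ ⟨c, hc, rfl⟩
  exact hw c hc

/-- a separating point lies on every arc -/
theorem aux_mem {T : Type*} [MetricSpace T] {α : ℝ → T} {a b : ℝ} {w : T}
    (hα : ∀ s ∈ Set.Icc a b, ∀ t ∈ Set.Icc a b, dist (α s) (α t) = |s - t|) (hab : a ≤ b)
    (h : connectedComponentIn ({w}ᶜ) (α a) ≠ connectedComponentIn ({w}ᶜ) (α b)) :
    ∃ c ∈ Set.Icc a b, α c = w := by
  by_contra! hc
  exact h (aux_comp hα le_rfl hab le_rfl hc)

theorem aux_dist {T : Type*} [MetricSpace T] (hT : IsRealTree T) {x y w : T}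
    (h : connectedComponentIn ({w}ᶜ) x ≠ connectedComponentIn ({w}ᶜ) y) :
    dist x y = dist x w + dist w y := by
  have hxy : x ≠ y := by rintro rfl; exact h rfl
  obtain ⟨a, b, hab, α, hα, rfl, rfl, -⟩ := hT.2.2 x y hxy
  obtain ⟨c, hc, rfl⟩ := aux_mem hα hab.le h
  have ha : a ∈ Set.Icc a b := Set.left_mem_Icc.2 hab.le
  have hb : b ∈ Set.Icc a b := Set.right_mem_Icc.2 hab.le
  rw [hα a ha b hb, hα a ha c hc, hα c hc b hb, abs_of_nonpos (by linarith),
    abs_of_nonpos (by linarith [hc.1]), abs_of_nonpos (by linarith [hc.2])]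
  ring

theorem aux_ne_of_not_mem {T : Type*} [MetricSpace T] {x y w : T} (hy : y ≠ w)
    (h : y ∉ connectedComponentIn ({w}ᶜ) x) :
    connectedComponentIn ({w}ᶜ) x ≠ connectedComponentIn ({w}ᶜ) y := by
  intro he
  exact h (he ▸ mem_connectedComponentIn (by simpa using hy))

theorem aux_branch_eq {T : Type*} [MetricSpace T] (hT : IsRealTree T) {p x : T} (hxp : x ≠ p) :
    ∃ u : ℕ → T, connectedComponentIn ({p}ᶜ) x = ⋃ n, {y | dist y (u n) < dist y p} := by
  obtain ⟨a, b, hab, α, hα, hαa, hαb, hsep⟩ := hT.2.2 p x hxp.symm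
  have hpos : ∀ n : ℕ, 0 < (b - a) / (n + 2) := fun n => by
    have : 0 < b - a := by linarith
    positivity
  have hlt : ∀ n : ℕ, (b - a) / (n + 2) < b - a := fun n => by
    apply div_lt_self (by linarith)
    have : (0 : ℝ) ≤ n := Nat.cast_nonneg n
    linarith
  have ha : a ∈ Set.Icc a b := Set.left_mem_Icc.2 hab.le
  have hb : b ∈ Set.Icc a b := Set.right_mem_Icc.2 hab.le
  have hmem : ∀ n : ℕ, a + (b - a) / (n + 2) ∈ Set.Icc a b := fun n =>
    ⟨by linarith [hpos n], by linarith [hlt n]⟩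
  have hd : ∀ n : ℕ, dist p (α (a + (b - a) / (n + 2))) = (b - a) / (n + 2) := fun n => by
    rw [← hαa, hα a ha _ (hmem n), abs_of_nonpos (by linarith [hpos n])]
    ring
  refine ⟨fun n => α (a + (b - a) / (n + 2)), ?_⟩
  ext y
  simp only [Set.mem_iUnion, Set.mem_ofPred_eq]
  constructor
  · intro hy
    have hyp : y ≠ p := by
      have := connectedComponentIn_subset _ _ hy
      simpa using this
    -- a positive radius ball around p which an arc from y to x avoids
    obtain ⟨K, hK, hpK, hKeq⟩ : ∃ K : Set T, IsClosed K ∧ p ∉ K ∧ ∀ w, w ∉ K →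
        connectedComponentIn ({w}ᶜ) y = connectedComponentIn ({w}ᶜ) x := by
      by_cases hyx : y = x
      · exact ⟨{x}, isClosed_singleton, by simpa using hxp.symm, fun w _ => by rw [hyx]⟩
      obtain ⟨a', b', hab', β, hβ, hβa, hβb, hβs⟩ := hT.2.2 y x hyx
      refine ⟨β '' Set.Icc a' b', (isCompact_Icc.image_of_continuousOn (aux_cont hβ)).isClosed,
        ?_, ?_⟩
      · rintro ⟨c, hc, rfl⟩
        have h1 : a' ≠ c := by rintro rfl; exact hyp hβa.symm
        have h2 : c ≠ b' := by rintro rfl; exact hxp hβb.symm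
        exact hβs c (lt_of_le_of_ne hc.1 h1) (lt_of_le_of_ne hc.2 h2)
          (connectedComponentIn_eq hy).symm
      · intro w hw
        have := aux_comp (w := w) hβ le_rfl hab'.le le_rfl
          (fun c hc h => hw ⟨c, hc, h⟩)
        rwa [hβa, hβb] at this
    obtain ⟨δ, hδ, hball⟩ := Metric.isOpen_iff.1 hK.isOpen_compl p hpK
    obtain ⟨n, hn⟩ := exists_nat_gt ((b - a) / δ)
    refine ⟨n, ?_⟩
    have hsm : (b - a) / (n + 2) < δ := by
      have hn0 : (0 : ℝ) ≤ n := Nat.cast_nonneg n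
      rw [div_lt_iff₀ hδ] at hn
      rw [div_lt_iff₀ (by positivity)]
      nlinarith
    have hout : α (a + (b - a) / (n + 2)) ∉ K := by
      apply hball
      rw [Metric.mem_ball, dist_comm, hd]
      exact hsm
    have hs := hsep (a + (b - a) / (n + 2)) (by linarith [hpos n]) (by linarith [hlt n])
    rw [← hKeq _ hout] at hs
    have := aux_dist hT hs.symm
    have h3 := hd n
    rw [dist_comm] at h3
    linarith [hpos n]
  · rintro ⟨n, hn⟩
    by_contra hy
    by_cases hyp : y = p
    · rw [hyp, dist_self] at hn
      exact absurd hn (not_lt.2 dist_nonneg)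
    have hs := aux_ne_of_not_mem hyp hy
    have he : connectedComponentIn ({p}ᶜ) (α (a + (b - a) / (n + 2))) =
        connectedComponentIn ({p}ᶜ) (α b) := by
      refine aux_comp hα (hmem n).1 (hmem n).2 le_rfl ?_
      intro c hc h
      rw [← hαa] at h
      have hc' : c ∈ Set.Icc a b := ⟨(hmem n).1.trans hc.1, hc.2⟩
      have := hα c hc' a ha
      rw [h, dist_self, abs_of_nonneg (by linarith [hc'.1])] at this
      linarith [hpos n, hc.1]
    rw [hαb] at he
    rw [← he] at hs
    have := aux_dist hT hs.symm
    have h3 := hd n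
    linarith [hpos n]

theorem aux_branch_meas {T : Type*} [MetricSpace T] [MeasurableSpace T] (hT : IsRealTree T)
    (hballs : ∀ (x : T) (s : ℝ), MeasurableSet (Metric.ball x s)) {p x : T} (hxp : x ≠ p) :
    MeasurableSet (connectedComponentIn ({p}ᶜ) x) := by
  obtain ⟨u, hu⟩ := aux_branch_eq hT hxp
  rw [hu]
  have hm : ∀ z : T, Measurable (fun y => dist y z) := fun z =>
    measurable_of_Iio fun s => hballs z s
  exact MeasurableSet.iUnion fun n => measurableSet_lt (hm _) (hm _)

theorem aux_inner {T : Type*} [MetricSpace T] [MeasurableSpace T] (μ : Measure T)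
    [IsProbabilityMeasure μ] {p q x : T} (hp : p ∈ treeCore μ) (hq : q ∈ treeCore μ)
    (hpx : p ≠ x) (hqx : q ≠ x)
    (h : connectedComponentIn ({x}ᶜ) p ≠ connectedComponentIn ({x}ᶜ) q) :
    IsInnerPoint μ x := by
  rintro ⟨B, ⟨z, hzx, rfl⟩, hB⟩
  have hsub : {p : T | IsInnerPoint μ p} ⊆ connectedComponentIn ({x}ᶜ) z := by
    intro y hy
    by_contra hyB
    apply hy
    have hyz : z ≠ y := by
      rintro rfl
      exact hyB (mem_connectedComponentIn (by simpa using hzx))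
    refine ⟨_, ⟨z, hyz, rfl⟩, le_antisymm prob_le_one ?_⟩
    rw [← hB]
    apply measure_mono
    refine isPreconnected_connectedComponentIn.subset_connectedComponentIn
      (mem_connectedComponentIn (by simpa using hzx)) ?_
    intro v hv hvy
    rw [Set.mem_singleton_iff] at hvy
    exact hyB (hvy ▸ hv)
  have key : ∀ y ∈ treeCore μ, y ≠ x →
      connectedComponentIn ({x}ᶜ) z = connectedComponentIn ({x}ᶜ) y := by
    intro y hy hyx
    have hcl : y ∈ closure (connectedComponentIn ({x}ᶜ) z) := closure_mono hsub hy
    apply connectedComponentIn_eq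
    have hpre : IsPreconnected (insert y (connectedComponentIn ({x}ᶜ) z)) :=
      isPreconnected_connectedComponentIn.subset_closure (Set.subset_insert _ _)
        (Set.insert_subset hcl subset_closure)
    refine hpre.subset_connectedComponentIn
      (Set.mem_insert_of_mem _ (mem_connectedComponentIn (by simpa using hzx))) ?_
      (Set.mem_insert _ _)
    exact Set.insert_subset (by simpa using hyx) (connectedComponentIn_subset _ _)
  exact h ((key p hp hpx).symm.trans (key q hq hqx))

theorem aux_fiber {T : Type*} [MetricSpace T] [MeasurableSpace T] (hT : IsRealTree T)
    (μ : Measure T) [IsProbabilityMeasure μ]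
    (hballs : ∀ (x : T) (s : ℝ), MeasurableSet (Metric.ball x s)) (p₀ : T) (r : ℝ) :
    {q : T | IsInnerPoint μ q ∧ dist p₀ q = r}.Countable := by
  by_cases hr : r = 0
  · apply (Set.countable_singleton p₀).mono
    rintro q ⟨-, hq⟩
    rw [hr, dist_eq_zero] at hq
    exact hq.symm
  let I := {q : T | IsInnerPoint μ q ∧ dist p₀ q = r}
  have hne : ∀ q : I, p₀ ≠ q.1 := fun q h => by
    apply hr
    rw [← q.2.2, ← h, dist_self]
  let A : I → Set T := fun q => (connectedComponentIn ({q.1}ᶜ) p₀)ᶜ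
  have hA : ∀ q, MeasurableSet (A q) := fun q => (aux_branch_meas hT hballs (hne q)).compl
  have hpos : ∀ q, 0 < μ (A q) := fun q => by
    rw [pos_iff_ne_zero]
    intro h0
    apply q.2.1
    refine ⟨_, ⟨p₀, hne q, rfl⟩, ?_⟩
    exact (prob_compl_eq_zero_iff (aux_branch_meas hT hballs (hne q))).1 h0
  have hdisj : Pairwise (Function.onFun Disjoint A) := by
    intro q q' hqq
    rw [Function.onFun, Set.disjoint_left]
    intro y hy hy'
    apply hqq
    by_cases hyp : p₀ = y
    · exfalso
      subst hyp
      exact hy (mem_connectedComponentIn (by simpa using hne q))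
    obtain ⟨a, b, hab, α, hα, hαa, hαb, -⟩ := hT.2.2 p₀ y hyp
    have ha : a ∈ Set.Icc a b := Set.left_mem_Icc.2 hab.le
    have hb : b ∈ Set.Icc a b := Set.right_mem_Icc.2 hab.le
    have key : ∀ z : I, y ∈ A z → z.1 = α (a + r) := by
      intro z hz
      have : ∃ c ∈ Set.Icc a b, α c = z.1 := by
        by_cases hyz : y = z.1
        · exact ⟨b, hb, hαb.trans hyz⟩
        · apply aux_mem hα hab.le
          rw [hαa, hαb]
          exact aux_ne_of_not_mem hyz hz
      obtain ⟨c, hc, hcz⟩ := this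
      have h1 := z.2.2
      rw [← hcz, ← hαa, hα a ha c hc, abs_of_nonpos (by linarith [hc.1])] at h1
      rw [← hcz]
      congr 1
      linarith
    exact Subtype.ext ((key q hy).trans (key q' hy').symm)
  have := Measure.countable_meas_pos_of_disjoint_iUnion (μ := μ) hA hdisj
  have hu : {q : I | 0 < μ (A q)} = Set.univ := Set.eq_univ_of_forall hpos
  rw [hu, Set.countable_univ_iff] at this
  exact Set.countable_coe_iff.1 this

theorem aux_dense {T : Type*} [MetricSpace T] [MeasurableSpace T] (hT : IsRealTree T)
    (μ : Measure T) [IsProbabilityMeasure μ] (p₀ p q : T)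
    (hp : p ∈ treeCore μ) (hq : q ∈ treeCore μ) (hpq : p ≠ q) (S : Set T)
    (hS : IsSegment p q S) :
    S ⊆ closure ({x : T | IsInnerPoint μ x ∧ ∃ s : ℚ, dist p₀ x = (s : ℝ)} ∩ S) := by
  obtain ⟨a, b, hab, α, hα, hαa, hαb, rfl, hsep⟩ := hS
  have hlt : a < b := lt_of_le_of_ne hab (by rintro rfl; exact hpq (hαa.symm.trans hαb))
  have ha : a ∈ Set.Icc a b := Set.left_mem_Icc.2 hab
  have hb : b ∈ Set.Icc a b := Set.right_mem_Icc.2 hab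
  have hinj : ∀ s ∈ Set.Icc a b, ∀ t ∈ Set.Icc a b, α s = α t → s = t := by
    intro s hs t ht h
    have := hα s hs t ht
    rw [h, dist_self] at this
    linarith [abs_eq_zero.1 this.symm]
  -- the distance from p₀ takes two different values on any subinterval
  have hnc : ∀ s t, a ≤ s → s < t → t ≤ b → ∃ u ∈ Set.Icc s t, ∃ v ∈ Set.Icc s t,
      dist p₀ (α u) < dist p₀ (α v) := by
    intro s t has hst htb
    by_contra! hcon
    have hms : s < (s + t) / 2 := by linarith
    have hmt : (s + t) / 2 < t := by linarith
    set c := (s + t) / 2 with hc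
    have hcm : c ∈ Set.Icc a b := ⟨by linarith, by linarith⟩
    have hsm : s ∈ Set.Icc a b := ⟨by linarith, by linarith⟩
    have htm : t ∈ Set.Icc a b := ⟨by linarith, by linarith⟩
    have hs1 : connectedComponentIn ({α c}ᶜ) (α a) = connectedComponentIn ({α c}ᶜ) (α s) := by
      refine aux_comp hα le_rfl has (by linarith) ?_
      intro d hd h
      have := hinj d ⟨hd.1, by linarith [hd.2]⟩ c hcm h
      linarith [hd.2]
    have ht1 : connectedComponentIn ({α c}ᶜ) (α t) = connectedComponentIn ({α c}ᶜ) (α b) := by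
      refine aux_comp hα (by linarith) htb le_rfl ?_
      intro d hd h
      have := hinj d ⟨by linarith [hd.1], hd.2⟩ c hcm h
      linarith [hd.1]
    have hne := hsep c (by linarith) (by linarith)
    rw [← hαa, ← hαb, hs1, ← ht1] at hne
    by_cases h : connectedComponentIn ({α c}ᶜ) p₀ = connectedComponentIn ({α c}ᶜ) (α s)
    · have h' := aux_dist hT (h.trans_ne hne)
      have h2 := hcon c ⟨hms.le, hmt.le⟩ t ⟨hst.le, le_rfl⟩
      have h3 := hα c hcm t htm
      rw [abs_of_nonpos (by linarith)] at h3
      linarith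
    · have h' := aux_dist hT h
      have h2 := hcon c ⟨hms.le, hmt.le⟩ s ⟨le_rfl, hst.le⟩
      have h3 := hα c hcm s hsm
      rw [abs_of_nonneg (by linarith)] at h3
      linarith
  -- rational parameter near any point
  have hex : ∀ s t, a < s → s < t → t < b → ∃ c ∈ Set.Icc s t,
      α c ∈ {x : T | IsInnerPoint μ x ∧ ∃ s : ℚ, dist p₀ x = (s : ℝ)} ∩ α '' Set.Icc a b := by
    intro s t has hst htb
    obtain ⟨u, hu, v, hv, huv⟩ := hnc s t has.le hst htb.le
    obtain ⟨k, hk1, hk2⟩ := exists_rat_btwn huv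
    have hcont : ContinuousOn (fun c => dist p₀ (α c)) (Set.Icc s t) :=
      (continuous_const.dist continuous_id).comp_continuousOn ((aux_cont hα).mono (Set.Icc_subset_Icc has.le htb.le))
    have := isPreconnected_Icc.intermediate_value hu hv hcont
    obtain ⟨c, hc, hck⟩ := this ⟨hk1.le, hk2.le⟩
    have hcm : c ∈ Set.Icc a b := ⟨by linarith [hc.1], by linarith [hc.2]⟩
    refine ⟨c, hc, ⟨?_, k, hck⟩, c, hcm, rfl⟩
    refine aux_inner μ hp hq ?_ ?_ (hsep c (by linarith [hc.1]) (by linarith [hc.2]))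
    · intro h
      have := hinj a ha c hcm (hαa.trans h)
      linarith [hc.1]
    · intro h
      have := hinj b hb c hcm (hαb.trans h)
      linarith [hc.2]
  rintro _ ⟨c, hc, rfl⟩
  rw [Metric.mem_closure_iff]
  intro ε hε
  obtain ⟨s, t, has, hst, htb, hnear⟩ : ∃ s t, a < s ∧ s < t ∧ t < b ∧
      ∀ d ∈ Set.Icc s t, |c - d| < ε := by
    have h1 : max a (c - ε) < min b (c + ε) := by
      rw [max_lt_iff, lt_min_iff, lt_min_iff]
      exact ⟨⟨hlt, by linarith [hc.1]⟩, by linarith [hc.2], by linarith⟩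
    obtain ⟨s, hs1, hs2⟩ := exists_between h1
    obtain ⟨t, ht1, ht2⟩ := exists_between hs2
    rw [max_lt_iff] at hs1
    rw [lt_min_iff] at ht2
    refine ⟨s, t, hs1.1, ht1, ht2.1, fun d hd => ?_⟩
    rw [abs_lt]
    constructor <;> linarith [hd.1, hd.2, hs1.2, ht2.2]
  obtain ⟨d, hd, hdm⟩ := hex s t has hst htb
  refine ⟨α d, hdm, ?_⟩
  rw [hα c hc d ⟨by linarith [hd.1], by linarith [hd.2]⟩]
  exact hnear d hd

/-- The core of a semi-measured real tree is separable; the set `Q` of inner points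
at rational distance from a fixed core point `p₀` is countable and is dense in every
proper segment between core points. -/
theorem statement9 {T : Type} [MetricSpace T] [m : MeasurableSpace T]
    (hT : IsRealTree T) (μ : Measure T) [IsProbabilityMeasure μ]
    (hballs : ∀ (x : T) (s : ℝ), MeasurableSet (Metric.ball x s))
    (p₀ : T) (hp₀ : p₀ ∈ treeCore μ) :
    TopologicalSpace.IsSeparable (treeCore μ) ∧
    ({q : T | IsInnerPoint μ q ∧ ∃ s : ℚ, dist p₀ q = (s : ℝ)}).Countable ∧
    ∀ p ∈ treeCore μ, ∀ q ∈ treeCore μ, p ≠ q → ∀ S : Set T, IsSegment p q S →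
      S ⊆ closure ({x : T | IsInnerPoint μ x ∧ ∃ s : ℚ, dist p₀ x = (s : ℝ)} ∩ S) := by
  have hQ : ({q : T | IsInnerPoint μ q ∧ ∃ s : ℚ, dist p₀ q = (s : ℝ)}).Countable := by
    have : {q : T | IsInnerPoint μ q ∧ ∃ s : ℚ, dist p₀ q = (s : ℝ)} =
        ⋃ s : ℚ, {q : T | IsInnerPoint μ q ∧ dist p₀ q = (s : ℝ)} := by
      ext q
      simp
    rw [this]
    exact Set.countable_iUnion fun s => aux_fiber hT μ hballs p₀ s
  refine ⟨⟨_, hQ.insert p₀, ?_⟩, hQ, fun p hp q hq hpq S hS =>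
    aux_dense hT μ p₀ p q hp hq hpq S hS⟩
  intro q hq
  by_cases h : p₀ = q
  · exact subset_closure (h ▸ Set.mem_insert _ _)
  obtain ⟨a, b, hab, α, hα, hαa, hαb, hsep⟩ := hT.2.2 p₀ q h
  have := aux_dense hT μ p₀ p₀ q hp₀ hq h _ ⟨a, b, hab.le, α, hα, hαa, hαb, rfl, hsep⟩
    ⟨b, Set.right_mem_Icc.2 hab.le, hαb⟩
  exact closure_mono (Set.inter_subset_left.trans (Set.subset_insert _ _)) this

end
end

section
/- If D=(T,d,ν) is a long dendron, then the real tree (T,d) is separable. -/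
open scoped NNReal ENNReal

open MeasureTheory Metric Filter Topology Set
open scoped NNReal ENNReal

noncomputable section

theorem arcSet {T : Type*} [MetricSpace T] (hT : IsRealTree T) (r z : T) :
    ∃ C : Set T, IsPreconnected C ∧ r ∈ C ∧ z ∈ C ∧ (∀ w ∈ C, dist r w ≤ dist r z) ∧
      ∀ u ∈ C, ∀ v ∈ C, dist u v = |dist r u - dist r v| := by
  by_cases h : r = z
  · subst h
    exact ⟨{r}, isPreconnected_singleton, by simp, by simp, by simp, by simp⟩
  obtain ⟨a, b, hab, α, hα, ha, hb, -⟩ := hT.2.2 r z h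
  have ma : a ∈ Set.Icc a b := ⟨le_rfl, hab.le⟩
  have mb : b ∈ Set.Icc a b := ⟨hab.le, le_rfl⟩
  have hr : ∀ s ∈ Set.Icc a b, dist r (α s) = s - a := by
    intro s hs
    rw [← ha, hα a ma s hs, abs_sub_comm, abs_of_nonneg (by linarith [hs.1])]
  have hc : ContinuousOn α (Set.Icc a b) := by
    have : LipschitzOnWith 1 α (Set.Icc a b) := by
      apply LipschitzOnWith.of_dist_le_mul
      intro s hs t ht
      rw [hα s hs t ht, Real.dist_eq]; simp
    exact this.continuousOn
  refine ⟨α '' Set.Icc a b, isPreconnected_Icc.image _ hc, ⟨a, ma, ha⟩, ⟨b, mb, hb⟩, ?_, ?_⟩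
  · rintro _ ⟨s, hs, rfl⟩
    rw [hr s hs, ← hb, hr b mb]; linarith [hs.2]
  · rintro _ ⟨s, hs, rfl⟩ _ ⟨t, ht, rfl⟩
    rw [hr s hs, hr t ht, hα s hs t ht]; congr 1; ring

theorem isOpen_branch {T : Type*} [MetricSpace T] (hT : IsRealTree T) (p x : T) :
    IsOpen (connectedComponentIn ({p}ᶜ) x) := by
  rw [Metric.isOpen_iff]
  intro z hz
  have hzp : z ≠ p := connectedComponentIn_subset _ _ hz
  refine ⟨dist z p, dist_pos.2 hzp, fun w hw => ?_⟩
  rw [Metric.mem_ball, dist_comm] at hw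
  obtain ⟨C, hC, h1, h2, h3, -⟩ := arcSet hT z w
  rw [connectedComponentIn_eq hz]
  refine hC.subset_connectedComponentIn h1 ?_ h2
  rintro u hu rfl
  exact absurd (h3 _ hu) (not_le.2 hw)

/-- Cutting off a branch around a point away from the root. -/
theorem exists_branch {T : Type*} [MetricSpace T] (hT : IsRealTree T) (r x : T) {δ : ℝ}
    (hδ : 0 < δ) (hx : δ < dist r x) :
    ∃ p : T, x ≠ p ∧ r ≠ p ∧ dist x p = δ ∧ dist r p = dist r x - δ ∧
      r ∉ connectedComponentIn ({p}ᶜ) x := by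
  have hrx : r ≠ x := dist_pos.1 (hδ.trans hx)
  obtain ⟨a, b, hab, α, hα, ha, hb, hsep⟩ := hT.2.2 r x hrx
  have ma : a ∈ Set.Icc a b := ⟨le_rfl, hab.le⟩
  have mb : b ∈ Set.Icc a b := ⟨hab.le, le_rfl⟩
  have hd : dist r x = b - a := by
    rw [← ha, ← hb, hα a ma b mb, abs_sub_comm, abs_of_nonneg (by linarith)]
  have mc : b - δ ∈ Set.Icc a b := ⟨by linarith, by linarith⟩
  have h1 : dist x (α (b - δ)) = δ := by
    rw [← hb, hα b mb _ mc]; rw [show b - (b - δ) = δ by ring, abs_of_pos hδ]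
  have h2 : dist r (α (b - δ)) = dist r x - δ := by
    rw [hd, ← ha, hα a ma _ mc, abs_sub_comm, abs_of_nonneg (by linarith)]; ring
  refine ⟨α (b - δ), dist_pos.1 (by linarith), dist_pos.1 (by linarith), h1, h2, fun h => ?_⟩
  exact hsep (b - δ) (by linarith) (by linarith) (connectedComponentIn_eq h).symm

theorem close_of_common {T : Type*} [MetricSpace T] (hT : IsRealTree T) {r x y p q z : T}
    (hrp : r ≠ p) (hrq : r ≠ q)
    (hp : r ∉ connectedComponentIn ({p}ᶜ) x) (hq : r ∉ connectedComponentIn ({q}ᶜ) y)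
    (hzp : z ∈ connectedComponentIn ({p}ᶜ) x) (hzq : z ∈ connectedComponentIn ({q}ᶜ) y) :
    dist p q = |dist r p - dist r q| := by
  obtain ⟨C, hC, h1, h2, -, h4⟩ := arcSet hT r z
  have key : ∀ p x : T, r ∉ connectedComponentIn ({p}ᶜ) x →
      z ∈ connectedComponentIn ({p}ᶜ) x → p ∈ C := by
    intro p x hp hz
    by_contra hpC
    apply hp
    rw [connectedComponentIn_eq hz]
    refine hC.subset_connectedComponentIn h2 ?_ h1
    rintro u hu rfl
    exact hpC hu
  exact h4 p (key p x hp hzp) q (key q y hq hzq)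

/-- The underlying real tree of a long dendron is separable. -/
theorem statement10 (D : LongDendron) :
    TopologicalSpace.SeparableSpace D.carrier := by
  have hT := D.isRealTree
  have := D.isProb
  obtain ⟨r⟩ := hT.1
  suffices SecondCountableTopology D.carrier by infer_instance
  refine Metric.secondCountable_of_almost_dense_set fun ε hε => ?_
  -- a maximal separated set of points far from the root
  obtain ⟨S, hS⟩ := zorn_subset
    {S : Set D.carrier | (∀ x ∈ S, ε < dist r x) ∧ S.Pairwise fun x y => ε < dist x y} (by
      intro c hc hch
      refine ⟨⋃₀ c, ⟨?_, ?_⟩, fun s hs => Set.subset_sUnion_of_mem hs⟩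
      · rintro x ⟨s, hs, hx⟩
        exact (hc hs).1 x hx
      · exact (Set.pairwise_sUnion hch.directedOn).2 fun s hs => (hc hs).2)
  obtain ⟨hS1, hS2⟩ := hS.prop
  have ex : ∀ x : S, ∃ p : D.carrier, x.1 ≠ p ∧ r ≠ p ∧ dist x.1 p = ε / 4 ∧
      dist r p = dist r x.1 - ε / 4 ∧ r ∉ connectedComponentIn ({p}ᶜ) x.1 := fun x =>
    exists_branch hT r x.1 (by linarith) (by linarith [hS1 x.1 x.2])
  choose p hp1 hp2 hp3 hp4 hp5 using ex
  have hcount : ∀ n : ℤ, {x : S | ⌊dist r x.1 / (ε / 4)⌋ = n}.Countable := by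
    intro n
    set U : Set S := {x : S | ⌊dist r x.1 / (ε / 4)⌋ = n} with hU
    let As : U → Set (D.carrier × ℝ≥0) := fun x =>
      connectedComponentIn ({p x.1}ᶜ) x.1.1 ×ˢ Set.univ
    have h := Measure.countable_meas_pos_of_disjoint_iUnion (μ := D.ν) (As := As)
      (fun x => (isOpen_branch hT _ _).measurableSet.prod MeasurableSet.univ) (by
        intro x y hxy
        refine Set.disjoint_left.2 ?_
        rintro ⟨z, t⟩ hzx hzy
        have hd := close_of_common hT (hp2 x.1) (hp2 y.1) (hp5 x.1) (hp5 y.1) hzx.1 hzy.1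
        have hfl : ⌊dist r x.1.1 / (ε / 4)⌋ = ⌊dist r y.1.1 / (ε / 4)⌋ := x.2.trans y.2.symm
        have h1 := Int.abs_sub_lt_one_of_floor_eq_floor hfl
        rw [← sub_div, abs_div, abs_of_pos (show 0 < ε / 4 by linarith),
          div_lt_one (by linarith)] at h1
        rw [hp4, hp4, sub_sub_sub_cancel_right] at hd
        have hne : x.1.1 ≠ y.1.1 := fun e => hxy (Subtype.ext (Subtype.ext e))
        have h2 := hS2 x.1.2 y.1.2 hne
        have h3 := dist_triangle4 x.1.1 (p x.1) (p y.1) y.1.1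
        rw [dist_comm (p y.1) y.1.1, hp3, hp3] at h3
        linarith)
    have huniv : {x : U | 0 < D.ν (As x)} = Set.univ := by
      ext x
      simp only [Set.mem_setOf_eq, Set.mem_univ, iff_true]
      exact D.branch_pos _ ⟨p x.1, x.1.1, hp1 x.1, rfl⟩
    rw [huniv, Set.countable_univ_iff] at h
    exact Set.countable_coe_iff.1 h
  have hSc : S.Countable := by
    rw [← Set.countable_coe_iff, ← Set.countable_univ_iff]
    have hun := Set.countable_iUnion hcount
    refine hun.mono fun x _ => ?_
    rw [Set.mem_iUnion]
    exact ⟨⌊dist r x.1 / (ε / 4)⌋, rfl⟩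
  refine ⟨insert r S, hSc.insert r, fun x => ?_⟩
  by_contra! hcon
  have hxr := hcon r (Set.mem_insert _ _)
  have hxS : ∀ y ∈ S, ε < dist x y := fun y hy => hcon y (Set.mem_insert_of_mem _ hy)
  have hmem : x ∈ S := by
    refine hS.le_of_ge (y := insert x S) ⟨?_, ?_⟩ (Set.subset_insert _ _) (Set.mem_insert _ _)
    · rintro y (rfl | hy)
      · rwa [dist_comm]
      · exact hS1 y hy
    · refine hS2.insert fun y hy _ => ⟨hxS y hy, ?_⟩
      rw [dist_comm]; exact hxS y hy
  have := hxS x hmem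
  rw [dist_self] at this
  linarith

end
end

section
/- Let (T,d,μ) be a semi-measured real tree. Then the associated projection α : T → Core(T)×[0,∞), defined by α(p) = (π^T(p), d(p,π^T(p))), is measurable from (T,μ) to Core(T)×[0,∞) equipped with its Borel σ-algebra (where Core(T) carries the restriction of the metric d). -/
open scoped NNReal ENNReal

open MeasureTheory Metric Filter Topology Set
open scoped NNReal ENNReal

noncomputable section

theorem rt_arc_s11 {T : Type} [MetricSpace T] (hT : IsRealTree T) (x y : T) :
    ∃ α : ℝ → T, (∀ s ∈ Set.Icc 0 (dist x y), ∀ t ∈ Set.Icc 0 (dist x y),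
      dist (α s) (α t) = |s - t|) ∧ α 0 = x ∧ α (dist x y) = y ∧
      ∀ c : ℝ, 0 < c → c < dist x y →
        connectedComponentIn ({α c}ᶜ) x ≠ connectedComponentIn ({α c}ᶜ) y := by
  by_cases hxy : x = y
  · subst hxy
    refine ⟨fun _ => x, ?_, rfl, rfl, ?_⟩
    · intro s hs t ht
      simp only [dist_self, Set.Icc_self, Set.mem_singleton_iff] at hs ht
      simp [hs, ht]
    · intro c h1 h2
      simp only [dist_self] at h2
      linarith
  · obtain ⟨-, -, h⟩ := hT
    obtain ⟨a, b, hab, α, hiso, ha, hb, hsep⟩ := h x y hxy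
    have hd : dist x y = b - a := by
      rw [← ha, ← hb, hiso a ⟨le_refl _, hab.le⟩ b ⟨hab.le, le_refl _⟩, abs_sub_comm,
        abs_of_nonneg (by linarith)]
    rw [hd]
    refine ⟨fun s => α (a + s), ?_, by simpa using ha, by simpa using hb, ?_⟩
    · intro s hs t ht
      simp only
      rw [hiso _ ⟨by linarith [hs.1], by linarith [hs.2]⟩ _
        ⟨by linarith [ht.1], by linarith [ht.2]⟩]
      congr 1
      ring
    · intro c h1 h2
      exact hsep _ (by linarith) (by linarith)

theorem rt_arc_conn {T : Type} [MetricSpace T] {x y : T} {α : ℝ → T}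
    (hiso : ∀ s ∈ Set.Icc 0 (dist x y), ∀ t ∈ Set.Icc 0 (dist x y),
      dist (α s) (α t) = |s - t|) : IsPreconnected (α '' Set.Icc 0 (dist x y)) := by
  apply isPreconnected_Icc.image
  have : LipschitzOnWith 1 α (Set.Icc 0 (dist x y)) := by
    apply LipschitzOnWith.of_dist_le_mul
    intro s hs t ht
    rw [hiso s hs t ht, Real.dist_eq]
    simp
  exact this.continuousOn

/-- A segment as a connected set of points in between. -/
theorem rt_seg {T : Type} [MetricSpace T] (hT : IsRealTree T) (x y : T) :
    ∃ S : Set T, IsPreconnected S ∧ x ∈ S ∧ y ∈ S ∧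
      ∀ z ∈ S, dist x z + dist z y = dist x y := by
  obtain ⟨α, hiso, h0, h1, -⟩ := rt_arc_s11 hT x y
  have e0 : (0 : ℝ) ∈ Set.Icc 0 (dist x y) := ⟨le_refl _, dist_nonneg⟩
  have e1 : dist x y ∈ Set.Icc 0 (dist x y) := ⟨dist_nonneg, le_refl _⟩
  refine ⟨α '' Set.Icc 0 (dist x y), rt_arc_conn hiso, ⟨0, e0, h0⟩, ⟨_, e1, h1⟩, ?_⟩
  rintro _ ⟨s, hs, rfl⟩
  have i0 := hiso 0 e0 s hs
  have i1 := hiso s hs _ e1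
  rw [h0] at i0
  rw [h1] at i1
  rw [i0, i1, abs_of_nonpos (by linarith [hs.1]),
    abs_of_nonpos (by linarith [hs.2])]
  ring

theorem comp_eq_of_conn {T : Type} [MetricSpace T] {p x y : T} {S : Set T}
    (hS : IsPreconnected S) (hx : x ∈ S) (hy : y ∈ S) (hp : p ∉ S) :
    connectedComponentIn ({p}ᶜ) x = connectedComponentIn ({p}ᶜ) y := by
  apply connectedComponentIn_eq
  refine hS.subset_connectedComponentIn hx ?_ hy
  intro z hz hzp
  exact hp (hzp ▸ hz)

/-- uniqueness together with separation -/
theorem rt_btw {T : Type} [MetricSpace T] (hT : IsRealTree T) (x y : T) :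
    ∃ α : ℝ → T, (∀ s, 0 ≤ s → s ≤ dist x y →
        dist x (α s) = s ∧ dist (α s) y = dist x y - s) ∧
      (∀ p, dist x p + dist p y = dist x y → p = α (dist x p)) ∧
      (∀ p, p ≠ x → p ≠ y → dist x p + dist p y = dist x y →
        connectedComponentIn ({p}ᶜ) x ≠ connectedComponentIn ({p}ᶜ) y) := by
  obtain ⟨α, hiso, h0, h1, hsep⟩ := rt_arc_s11 hT x y
  have e0 : (0 : ℝ) ∈ Set.Icc 0 (dist x y) := ⟨le_refl _, dist_nonneg⟩
  have e1 : dist x y ∈ Set.Icc 0 (dist x y) := ⟨dist_nonneg, le_refl _⟩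
  have A : ∀ s, 0 ≤ s → s ≤ dist x y →
        dist x (α s) = s ∧ dist (α s) y = dist x y - s := by
    intro s hs hs'
    have i0 := hiso 0 e0 s ⟨hs, hs'⟩
    have i1 := hiso s ⟨hs, hs'⟩ _ e1
    rw [h0] at i0
    rw [h1] at i1
    rw [i0, i1, abs_of_nonpos (by linarith), abs_of_nonpos (by linarith)]
    constructor <;> ring
  have B : ∀ p, dist x p + dist p y = dist x y → p = α (dist x p) := by
    intro p hp
    by_cases hx : p = x
    · subst hx; simp [h0]
    by_cases hy : p = y
    · subst hy; exact h1.symm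
    have p1 : 0 < dist x p := dist_pos.2 (Ne.symm hx)
    have p2 : 0 < dist p y := dist_pos.2 hy
    obtain ⟨a1, a2⟩ := A (dist x p) p1.le (by linarith)
    obtain ⟨S1, c1, m1, m1', b1⟩ := rt_seg hT x p
    obtain ⟨S2, c2, m2, m2', b2⟩ := rt_seg hT p y
    have hc : IsPreconnected (S1 ∪ S2) := c1.union p m1' m2 c2
    have hz : α (dist x p) ∈ S1 ∪ S2 := by
      by_contra hz
      exact hsep (dist x p) p1 (by linarith)
        (comp_eq_of_conn hc (Or.inl m1) (Or.inr m2') hz)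
    rcases hz with hz | hz
    · have := b1 _ hz
      have h : dist (α (dist x p)) p = 0 := by linarith
      exact (dist_eq_zero.1 h).symm
    · have := b2 _ hz
      have h : dist p (α (dist x p)) = 0 := by linarith
      exact (dist_eq_zero.1 h)
  refine ⟨α, A, B, ?_⟩
  intro p hx hy hp
  have p1 : 0 < dist x p := dist_pos.2 (Ne.symm hx)
  have p2 : 0 < dist p y := dist_pos.2 hy
  have := hsep (dist x p) p1 (by linarith)
  rwa [← B p hp] at this

theorem rt_exists {T : Type} [MetricSpace T] (hT : IsRealTree T) (x y : T) (s : ℝ)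
    (h0 : 0 ≤ s) (h1 : s ≤ dist x y) : ∃ z, dist x z = s ∧ dist z y = dist x y - s := by
  obtain ⟨α, A, -, -⟩ := rt_btw hT x y
  exact ⟨α s, A s h0 h1⟩

theorem rt_unique {T : Type} [MetricSpace T] (hT : IsRealTree T) {x y p q : T}
    (hp : dist x p + dist p y = dist x y) (hq : dist x q + dist q y = dist x y)
    (h : dist x p = dist x q) : p = q := by
  obtain ⟨α, -, B, -⟩ := rt_btw hT x y
  rw [B p hp, B q hq, h]

theorem rt_comp_iff {T : Type} [MetricSpace T] (hT : IsRealTree T) {x y p : T}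
    (hx : p ≠ x) (hy : p ≠ y) :
    connectedComponentIn ({p}ᶜ) x = connectedComponentIn ({p}ᶜ) y ↔
      dist x p + dist p y ≠ dist x y := by
  constructor
  · intro h h'
    obtain ⟨α, -, -, C⟩ := rt_btw hT x y
    exact C p hx hy h' h
  · intro h
    obtain ⟨S, c, m, m', b⟩ := rt_seg hT x y
    exact comp_eq_of_conn c m m' (fun hp => h (b p hp))

theorem rt_mem_comp {T : Type} [MetricSpace T] (hT : IsRealTree T) {x y p : T}
    (hx : p ≠ x) (hy : p ≠ y) :
    y ∈ connectedComponentIn ({p}ᶜ) x ↔ dist x p + dist p y ≠ dist x y := by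
  rw [← rt_comp_iff hT hx hy]
  constructor
  · intro h
    exact connectedComponentIn_eq h
  · intro h
    rw [h]
    exact mem_connectedComponentIn (fun h' => hy h'.symm)

theorem rt_three {T : Type} [MetricSpace T] (hT : IsRealTree T) {x y z : T} (b : T)
    (h : dist x z + dist z y = dist x y) :
    dist x z + dist z b = dist x b ∨ dist y z + dist z b = dist y b := by
  by_cases hx : z = x
  · subst hx; left; simp
  by_cases hy : z = y
  · subst hy; right; simp
  by_cases hb : z = b
  · subst hb; left; simp
  by_contra hcon
  push Not at hcon
  have h1 := (rt_comp_iff hT hx hb).2 hcon.1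
  have h2 := (rt_comp_iff hT hy hb).2 hcon.2
  exact (rt_comp_iff hT hx hy).1 (h1.trans h2.symm) h

theorem inner_aux {T : Type} [MetricSpace T] [MeasurableSpace T] (hT : IsRealTree T)
    (μ : Measure T) [IsProbabilityMeasure μ] {x z b : T} (hx : IsInnerPoint μ x)
    (hzx : z ≠ x) (hbz : b ≠ z)
    (hxB : x ∉ connectedComponentIn ({z}ᶜ) b) :
    μ (connectedComponentIn ({z}ᶜ) b) ≠ 1 := by
  intro hB
  apply hx
  refine ⟨connectedComponentIn ({x}ᶜ) z, ⟨z, hzx, rfl⟩, le_antisymm prob_le_one ?_⟩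
  rw [← hB]
  apply measure_mono
  intro c hc
  have hcz : c ≠ z := fun h => connectedComponentIn_subset _ _ hc h
  have hcx : c ≠ x := fun h => hxB (h ▸ hc)
  have e := connectedComponentIn_eq hc
  rw [e, rt_mem_comp hT (Ne.symm hcz) hzx] at hxB
  push Not at hxB
  rw [rt_mem_comp hT (Ne.symm hzx) (Ne.symm hcx)]
  intro h
  have : 0 < dist z x := dist_pos.2 hzx
  rw [dist_comm z c, dist_comm x c] at h
  linarith

theorem inner_convex {T : Type} [MetricSpace T] [MeasurableSpace T] (hT : IsRealTree T)
    (μ : Measure T) [IsProbabilityMeasure μ] {x y z : T} (hx : IsInnerPoint μ x)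
    (hy : IsInnerPoint μ y) (h : dist x z + dist z y = dist x y) : IsInnerPoint μ z := by
  by_cases hzx : z = x
  · subst hzx; exact hx
  by_cases hzy : z = y
  · subst hzy; exact hy
  rintro ⟨B, ⟨b, hb, rfl⟩, hB⟩
  by_cases hxB : x ∈ connectedComponentIn ({z}ᶜ) b
  · by_cases hyB : y ∈ connectedComponentIn ({z}ᶜ) b
    · have h1 := connectedComponentIn_eq hxB
      have h2 := connectedComponentIn_eq hyB
      exact (rt_comp_iff hT hzx hzy).1 (h1.symm.trans h2) h
    · exact inner_aux hT μ hy hzy hb hyB hB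
  · exact inner_aux hT μ hx hzx hb hxB hB

theorem proj_btw {T : Type} [MetricSpace T] [MeasurableSpace T] (hT : IsRealTree T)
    (μ : Measure T) [IsProbabilityMeasure μ] {p c : T} (hc : c ∈ treeCore μ)
    (hmin : ∀ y ∈ treeCore μ, dist p c ≤ dist p y) {y : T} (hy : y ∈ treeCore μ) :
    dist c y = dist p y - dist p c := by
  have key : ∀ u v : T, IsInnerPoint μ u → IsInnerPoint μ v →
      2 * dist p c ≤ dist p u + dist p v - dist u v := by
    intro u v hu hv
    have t1 := dist_triangle u p v
    have t2 := dist_triangle v u p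
    have t3 := dist_triangle u v p
    rw [dist_comm v u] at t2
    obtain ⟨z, z1, z2⟩ := rt_exists hT u v ((dist u p + dist u v - dist v p) / 2)
      (by linarith) (by linarith [dist_comm p v])
    have hz : IsInnerPoint μ z := inner_convex hT μ hu hv (by linarith)
    have hm := hmin z (subset_closure hz)
    have := rt_three hT (x := u) (y := v) (z := z) p (by linarith)
    have c1 := dist_comm z p
    have c2 := dist_comm u p
    have c3 := dist_comm v p
    have c4 := dist_comm v z
    rcases this with h | h <;> linarith
  have hcl : IsClosed {w : T × T | 2 * dist p c ≤ dist p w.1 + dist p w.2 - dist w.1 w.2} :=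
    isClosed_le (by fun_prop) (by fun_prop)
  have hsub : closure ({p : T | IsInnerPoint μ p} ×ˢ {p : T | IsInnerPoint μ p}) ⊆
      {w : T × T | 2 * dist p c ≤ dist p w.1 + dist p w.2 - dist w.1 w.2} :=
    closure_minimal (fun w hw => key w.1 w.2 hw.1 hw.2) hcl
  have hm : (c, y) ∈ closure ({p : T | IsInnerPoint μ p} ×ˢ {p : T | IsInnerPoint μ p}) := by
    rw [closure_prod_eq]
    exact ⟨hc, hy⟩
  have := hsub hm
  simp only [Set.mem_setOf_eq] at this
  linarith [dist_triangle p c y]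

theorem dist_meas {T : Type} [MetricSpace T] [MeasurableSpace T]
    (hballs : ∀ (x : T) (s : ℝ), MeasurableSet (Metric.ball x s)) (r : T) :
    Measurable (fun x => dist r x) := by
  apply measurable_of_Iio
  intro s
  convert hballs r s using 1
  ext x
  simp [dist_comm]

theorem core_separable {T : Type} [MetricSpace T] [MeasurableSpace T] (hT : IsRealTree T)
    (μ : Measure T) [IsProbabilityMeasure μ]
    (hballs : ∀ (x : T) (s : ℝ), MeasurableSet (Metric.ball x s)) :
    TopologicalSpace.IsSeparable (treeCore μ) := by
  obtain ⟨r⟩ := hT.1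
  let S : T → Set T := fun p => {x | dist r p + dist p x = dist r x ∧ 0 < dist p x}
  have hSm : ∀ p, MeasurableSet (S p) := by
    intro p
    have h1 := dist_meas hballs r
    have h2 := dist_meas hballs p
    exact (measurableSet_eq_fun (measurable_const.add h2) h1).inter
      (measurableSet_lt measurable_const h2)
  have hSpos : ∀ p q, IsInnerPoint μ q → q ≠ r → p ≠ q → dist r p + dist p q = dist r q →
      0 < μ (S p) := by
    intro p q hq hqr hpq hb
    by_contra h0
    have h0 : μ (S p) = 0 := by simpa using h0
    apply hq
    refine ⟨connectedComponentIn ({q}ᶜ) r, ⟨r, hqr.symm, rfl⟩, le_antisymm prob_le_one ?_⟩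
    have h1 : μ (S p)ᶜ = 1 := (prob_compl_eq_one_iff (hSm p)).2 h0
    rw [← h1]
    apply measure_mono
    intro x hx
    have pq : 0 < dist p q := dist_pos.2 hpq
    have hxq : q ≠ x := by
      rintro rfl
      exact hx ⟨hb, pq⟩
    rw [rt_mem_comp hT hqr hxq]
    intro hbx
    apply hx
    have t1 := dist_triangle p q x
    have t2 := dist_triangle r p x
    refine ⟨by linarith, ?_⟩
    rw [dist_pos]
    rintro rfl
    have := dist_comm p q
    linarith
  let P : ℚ → Set T := fun h => {p | dist r p = h ∧ 0 < μ (S p)}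
  have hP : ∀ h, (P h).Countable := by
    intro h
    have := Measure.countable_meas_pos_of_disjoint_iUnion (μ := μ)
      (As := fun p : {p : T // dist r p = h} => S p.1) (fun p => hSm p.1) (by
        intro p q hpq
        rw [Function.onFun, Set.disjoint_left]
        intro x hx hx'
        exact hpq (Subtype.ext (rt_unique hT hx.1 hx'.1 (p.2.trans q.2.symm))))
    refine (this.image Subtype.val).mono ?_
    rintro p ⟨h1, h2⟩
    exact ⟨⟨p, h1⟩, h2, rfl⟩
  have hD : ({r} ∪ ⋃ h, P h : Set T).Countable :=
    (Set.countable_singleton r).union (Set.countable_iUnion hP)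
  refine TopologicalSpace.IsSeparable.closure ⟨_, hD, ?_⟩
  intro q hq
  by_cases hqr : q = r
  · subst hqr
    exact subset_closure (Or.inl rfl)
  rw [Metric.mem_closure_iff]
  intro ε hε
  have rq : 0 < dist r q := dist_pos.2 (Ne.symm hqr)
  obtain ⟨h, h1, h2⟩ := exists_rat_btwn (show max 0 (dist r q - ε) < dist r q by
    rw [max_lt_iff]; constructor <;> linarith)
  rw [max_lt_iff] at h1
  obtain ⟨p, p1, p2⟩ := rt_exists hT r q h h1.1.le h2.le
  refine ⟨p, Or.inr (Set.mem_iUnion.2 ⟨h, p1, hSpos p q hq hqr ?_ (by linarith)⟩), ?_⟩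
  · rintro rfl
    linarith
  · rw [dist_comm]
    linarith

theorem meas_prod_aux {T Y : Type} [MeasurableSpace T] [MetricSpace Y]
    [TopologicalSpace.SeparableSpace Y] (f : T → Y) (g : T → ℝ≥0)
    (hf : ∀ y, Measurable (fun t => dist (f t) y)) (hg : Measurable g) :
    @Measurable T (Y × ℝ≥0) _ (borel _) (fun t => (f t, g t)) := by
  letI : MeasurableSpace Y := borel Y
  haveI : BorelSpace Y := ⟨rfl⟩
  haveI : SecondCountableTopology Y := UniformSpace.secondCountable_of_separable Y
  rw [← BorelSpace.measurable_eq (α := Y × ℝ≥0)]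
  refine Measurable.prodMk ?_ hg
  have hb : TopologicalSpace.IsTopologicalBasis {u : Set Y | ∃ y s, u = Metric.ball y s} := by
    apply TopologicalSpace.isTopologicalBasis_of_isOpen_of_nhds
    · rintro _ ⟨y, s, rfl⟩
      exact Metric.isOpen_ball
    · intro a u ha hu
      obtain ⟨ε, hε, h⟩ := Metric.isOpen_iff.1 hu a ha
      exact ⟨_, ⟨a, ε, rfl⟩, Metric.mem_ball_self hε, h⟩
  have := hb.borel_eq_generateFrom
  change @Measurable T Y _ (borel Y) f
  rw [this]
  apply measurable_generateFrom
  rintro _ ⟨y, s, rfl⟩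
  exact hf y measurableSet_Iio

/-- The associated projection `α(p) = (π(p), d(p,π(p)))` of a semi-measured real tree
is measurable into `Core(T) × [0,∞)` with its Borel σ-algebra. -/
theorem statement11 {T : Type} [MetricSpace T] [m : MeasurableSpace T]
    (hT : IsRealTree T) (μ : Measure T) [IsProbabilityMeasure μ]
    (hballs : ∀ (x : T) (s : ℝ), MeasurableSet (Metric.ball x s))
    (π : T → T) (hπY : ∀ t, π t ∈ treeCore μ)
    (hπ : ∀ t, ∀ y ∈ treeCore μ, dist t (π t) ≤ dist t y) :
    @Measurable T (↥(treeCore μ) × ℝ≥0) m (coreBorel μ) (assocProj μ π hπY) := by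
  haveI : TopologicalSpace.SeparableSpace ↥(treeCore μ) :=
    (core_separable hT μ hballs).separableSpace
  have hd : Measurable (fun p => dist p (π p)) := by
    obtain ⟨D, hDc, hDd⟩ := TopologicalSpace.exists_countable_dense ↥(treeCore μ)
    apply measurable_of_Iio
    intro s
    have : (fun p => dist p (π p)) ⁻¹' Set.Iio s = ⋃ y ∈ D, Metric.ball (y : T) s := by
      ext p
      simp only [Set.mem_preimage, Set.mem_Iio, Set.mem_iUnion, Metric.mem_ball, exists_prop]
      constructor
      · intro h
        obtain ⟨y, hy, hyd⟩ := hDd.exists_dist_lt ⟨π p, hπY p⟩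
          (show 0 < s - dist p (π p) by linarith)
        refine ⟨y, hy, ?_⟩
        rw [Subtype.dist_eq] at hyd
        linarith [dist_triangle p (π p) y]
      · rintro ⟨y, -, hy⟩
        exact (hπ p y y.2).trans_lt hy
    rw [this]
    exact MeasurableSet.biUnion hDc (fun y _ => hballs y s)
  refine meas_prod_aux (fun p => (⟨π p, hπY p⟩ : ↥(treeCore μ)))
    (fun p => ⟨dist p (π p), dist_nonneg⟩) ?_ (hd.subtype_mk)
  intro y
  have : (fun t => dist (⟨π t, hπY t⟩ : ↥(treeCore μ)) y) =
      fun t => dist (y : T) t - dist t (π t) := by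
    ext t
    rw [Subtype.dist_eq, dist_comm (y : T) t]
    exact proj_btw hT μ (hπY t) (hπ t) y.2
  rw [this]
  exact (dist_meas hballs (y : T)).sub hd

end
end
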